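/- arXiv:2302.01750 — 2 statements merged into one kernel-verified Lean document; each statement's English description precedes it below -/
import Mathlib

section
/- For all integers i ≥ 0 and n ≥ 0, A_{5, 15625 i + 4}(25 n + 21) ≡ 0 (mod 3125). -/
/-- Hook length of the cell in row `i`, column `j` (0-indexed) of the
Ferrers–Young diagram of the partition `p` (rows sorted in decreasing order). -/
def hookLength {n : ℕ} (p : n.Partition) (i j : ℕ) : ℕ :=
  (((p.parts.sort (· ≤ ·)).reverse.getD i 0 - j) +
    ((p.parts.filter (fun x => j < x)).card - i)) - 1

/-- A partition is a `t`-core if no hook number of its Ferrers–Young diagram is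
divisible by `t`. -/
def IsTCore (t : ℕ) {n : ℕ} (p : n.Partition) : Prop :=
  ∀ i j : ℕ, j < (p.parts.sort (· ≤ ·)).reverse.getD i 0 → ¬ t ∣ hookLength p i j

/-- `numA t k n` is the number of `k`-tuples of `t`-core partitions whose sizes sum to `n`. -/
noncomputable def numA (t k n : ℕ) : ℕ :=
  Nat.card { f : Fin k → Σ m : Fin (n + 1), Nat.Partition (m : ℕ) //
    (∑ i, ((f i).1 : ℕ)) = n ∧ ∀ i, IsTCore t (f i).2 }

namespace FiveCore

open PowerSeries Finset

/-- The finite Euler product `∏_{i < N} (1 - q ^ (i + 1))`. -/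
noncomputable def qfac (N : ℕ) : ℤ⟦X⟧ := ∏ i ∈ range N, (1 - X ^ (i + 1))

lemma qfac_succ (N : ℕ) : qfac (N + 1) = qfac N * (1 - X ^ (N + 1)) := prod_range_succ _ _

/-- The Euler product `∏_{i ≥ 1} (1 - q ^ i)`. -/
noncomputable abbrev euler : ℤ⟦X⟧ := pentagonalSeries ℤ

/-- Reduction modulo `q ^ (m + 1)`. -/
noncomputable abbrev red (m : ℕ) : ℤ⟦X⟧ →+* ℤ⟦X⟧ ⧸ Ideal.span {(X : ℤ⟦X⟧) ^ (m + 1)} :=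
  Ideal.Quotient.mk _

lemma red_eq_iff {m : ℕ} {f g : ℤ⟦X⟧} :
    red m f = red m g ↔ ∀ i ≤ m, coeff i f = coeff i g := by
  rw [Ideal.Quotient.eq, Ideal.mem_span_singleton, X_pow_dvd_iff]
  simp [sub_eq_zero]

lemma red_X_pow {m k : ℕ} (h : m < k) : red m (X ^ k) = 0 := by
  rw [Ideal.Quotient.eq_zero_iff_mem, Ideal.mem_span_singleton]
  exact pow_dvd_pow _ h

lemma ext_red {f g : ℤ⟦X⟧} (h : ∀ m, red m f = red m g) : f = g := by
  ext m
  exact red_eq_iff.1 (h m) m le_rfl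

lemma red_qfac_add (m N : ℕ) : red m (qfac (m + N)) = red m (qfac m) := by
  induction N with
  | zero => rfl
  | succ N ih =>
    rw [← add_assoc, qfac_succ, map_mul, ih, map_sub, red_X_pow (by omega)]
    simp

lemma red_qfac {m N : ℕ} (h : m ≤ N) : red m (qfac N) = red m euler := by
  obtain ⟨d, rfl⟩ := Nat.exists_eq_add_of_le h
  rw [red_qfac_add]
  refine red_eq_iff.2 fun i hi => ?_
  have h1 := coeff_prod_one_sub_X_pow_eventually_eq ℤ i
  obtain ⟨s, hs⟩ := Filter.eventually_atTop.1 h1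
  obtain ⟨K, hK⟩ := s.exists_nat_subset_range
  have h2 := hs (range (m + K)) (hK.trans (range_subset_range.2 (by omega)))
  rw [← h2]
  exact (red_eq_iff.1 (red_qfac_add m K) i hi).symm

lemma constantCoeff_qfac (N : ℕ) : constantCoeff (qfac N) = 1 := by
  induction N with
  | zero => simp [qfac]
  | succ N ih => rw [qfac_succ]; simp [ih]

/-- The inverse of `qfac N`. -/
noncomputable def qinv (N : ℕ) : ℤ⟦X⟧ := invOfUnit (qfac N) 1

lemma qfac_mul_qinv (N : ℕ) : qfac N * qinv N = 1 :=
  mul_invOfUnit _ _ (by simp [constantCoeff_qfac])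

lemma qinv_succ (N : ℕ) : qinv (N + 1) * (1 - X ^ (N + 1)) = qinv N := by
  have h1 := qfac_mul_qinv N
  have h2 := qfac_mul_qinv (N + 1)
  rw [qfac_succ] at h2
  linear_combination qinv N * h2 - qinv (N + 1) * (1 - X ^ (N + 1)) * h1

lemma constantCoeff_euler : constantCoeff euler = 1 := by
  have := red_eq_iff.1 (red_qfac (le_refl 0)) 0 le_rfl
  simpa [qfac] using this.symm

lemma exists_euler_inv : ∃ e : ℤ⟦X⟧, euler * e = 1 :=
  ⟨_, mul_invOfUnit euler 1 (by simp [constantCoeff_euler])⟩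

lemma red_qinv {m N : ℕ} (h : m ≤ N) {e : ℤ⟦X⟧} (he : euler * e = 1) :
    red m (qinv N) = red m e := by
  have h1 := congrArg (red m) (qfac_mul_qinv N)
  have h2 := congrArg (red m) he
  simp only [map_mul, red_qfac h, map_one] at h1 h2
  linear_combination red m e * h1 - red m (qinv N) * h2

/-! ### Jacobi's identity -/

lemma sum_odd_mul (f f' : ℕ → ℤ⟦X⟧) (Q : ℤ⟦X⟧)
    (h0 : f' 0 = (1 + Q ^ 2) * f 0 + Q * f 0 - Q * f 1)
    (hs : ∀ n, f' (n + 1) = (1 + Q ^ 2) * f (n + 1) - Q * (f n + f (n + 2))) (K : ℕ) :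
    ∑ n ∈ range (K + 1), (2 * n + 1) * f' n =
      (1 - Q) ^ 2 * ∑ n ∈ range (K + 1), (2 * n + 1) * f n
        - Q * ((2 * K + 1) * f (K + 1) - (2 * K + 3) * f K) := by
  induction K with
  | zero => simp [h0]; ring
  | succ K ih =>
    rw [sum_range_succ, ih, sum_range_succ _ (K + 1), hs]
    push_cast
    ring

/-- `1 / (q; q)_{N - n}`, read as zero when `n > N`. -/
noncomputable def qinvSub (N n : ℕ) : ℤ⟦X⟧ := if n ≤ N then qinv (N - n) else 0

/-- The coefficient of the finite form of Jacobi's identity. -/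
noncomputable def jac (N n : ℕ) : ℤ⟦X⟧ :=
  (-1) ^ n * X ^ (n * (n + 1) / 2) * qfac (2 * N + 1) * (qinvSub N n * qinv (N + n + 1))

lemma qinvSub_self (d n : ℕ) : qinvSub (d + n) n = qinv d := by simp [qinvSub]

lemma qinvSub_one (d n : ℕ) : qinvSub (d + n) (n + 1) = (1 - X ^ d) * qinv d := by
  rcases d with _ | d
  · simp [qinvSub]
  · rw [mul_comm, qinv_succ, show d + 1 + n = d + (n + 1) by ring, qinvSub_self]

lemma qinvSub_two (d n : ℕ) :
    qinvSub (d + 1 + n) (n + 2) = (1 - X ^ d) * ((1 - X ^ (d + 1)) * qinv (d + 1)) := by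
  rw [show d + 1 + n = d + (n + 1) by ring, qinvSub_one, mul_comm _ (qinv (d + 1)), qinv_succ]

lemma tri_succ (n : ℕ) : (n + 1) * (n + 1 + 1) / 2 = n * (n + 1) / 2 + (n + 1) := by
  rw [show (n + 1) * (n + 1 + 1) = n * (n + 1) + (n + 1) * 2 by ring,
    Nat.add_mul_div_right _ _ two_pos]

lemma qfac_odd_succ (N : ℕ) : qfac (2 * (N + 1) + 1) =
    qfac (2 * N + 1) * (1 - X ^ (2 * N + 2)) * (1 - X ^ (2 * N + 3)) := by
  rw [show 2 * (N + 1) + 1 = 2 * N + 1 + 1 + 1 by ring, qfac_succ, qfac_succ]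

lemma jac_succ_zero (N : ℕ) :
    jac (N + 1) 0 = (1 + (X ^ (N + 1)) ^ 2) * jac N 0 + X ^ (N + 1) * jac N 0
      - X ^ (N + 1) * jac N 1 := by
  have h1 : qinvSub N 1 = (1 - X ^ N) * qinv N := qinvSub_one N 0
  have h2 (M : ℕ) : qinvSub M 0 = qinv M := qinvSub_self M 0
  simp only [jac, h1, h2, qfac_odd_succ, add_zero]
  rw [← qinv_succ N, ← qinv_succ (N + 1)]
  simp
  ring

lemma jac_succ (N n : ℕ) (h : n ≤ N) :
    jac (N + 1) (n + 1) =
      (1 + (X ^ (N + 1)) ^ 2) * jac N (n + 1) - X ^ (N + 1) * (jac N n + jac N (n + 2)) := by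
  obtain ⟨d, rfl⟩ := Nat.exists_eq_add_of_le' h
  have e0 : qinvSub (d + n + 1) (n + 1) = qinv d := by
    rw [add_assoc, qinvSub_self]
  have e1 : qinv (d + n + (n + 1) + 1) =
      qinv (d + n + 1 + (n + 1) + 1) * (1 - X ^ (d + n + (n + 1) + 2)) := by
    rw [← qinv_succ (d + n + (n + 1) + 1)]; ring_nf
  have e2 : qinv (d + n + n + 1) = qinv (d + n + 1 + (n + 1) + 1)
      * (1 - X ^ (d + n + (n + 1) + 2)) * (1 - X ^ (d + n + n + 2)) := by
    rw [← e1, ← qinv_succ (d + n + n + 1)]; ring_nf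
  have e3 : qinv (d + n + (n + 2) + 1) = qinv (d + n + 1 + (n + 1) + 1) := by
    congr 1; ring
  simp only [jac, qfac_odd_succ, e0, e1, e2, e3, qinvSub_one, qinvSub_self,
    show n + 2 = n + 1 + 1 from rfl, tri_succ]
  rcases d with _ | d
  · have : qinvSub (0 + n) (n + 1 + 1) = 0 := by simp [qinvSub]
    rw [this]
    ring
  · rw [qinvSub_two]
    ring

lemma jac_eq_zero {N n : ℕ} (h : N < n) : jac N n = 0 := by
  simp [jac, qinvSub, not_le.2 h]

lemma sum_jac (N : ℕ) : ∑ n ∈ range (N + 1), (2 * n + 1) * jac N n = qfac N ^ 2 := by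
  induction N with
  | zero =>
    have h0 := qfac_mul_qinv 0
    have h1 := qfac_mul_qinv 1
    have hq : qfac 0 = 1 := by simp [qfac]
    rw [hq, one_mul] at h0
    simp [jac, qinvSub, h0, h1, hq]
  | succ N ih =>
    rw [sum_odd_mul (jac N) (jac (N + 1)) (X ^ (N + 1)) (jac_succ_zero N) ?_ (N + 1),
      sum_range_succ, ih, jac_eq_zero (show N < N + 1 by omega),
      jac_eq_zero (show N < N + 1 + 1 by omega), qfac_succ]
    · ring
    · intro n
      rcases le_or_gt n N with h | h
      · exact jac_succ N n h
      · simp [jac_eq_zero (show N < n by omega), jac_eq_zero (show N < n + 1 by omega),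
          jac_eq_zero (show N < n + 2 by omega), jac_eq_zero (show N + 1 < n + 1 by omega)]

lemma le_tri (n : ℕ) : n ≤ n * (n + 1) / 2 := by
  rw [Nat.le_div_iff_mul_le two_pos]
  rcases n with _ | n
  · rfl
  · exact Nat.mul_le_mul_left _ (by omega)

/-- Jacobi's identity for the cube of the Euler product, modulo `q ^ (m + 1)`. -/
lemma red_euler_cube (m : ℕ) :
    red m (euler ^ 3) =
      red m (∑ n ∈ range (2 * m + 1), (2 * (n : ℤ⟦X⟧) + 1) * (-1) ^ n * X ^ (n * (n + 1) / 2)) := by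
  obtain ⟨e, he⟩ := exists_euler_inv
  have he' := congrArg (red m) he
  simp only [map_mul, map_one] at he'
  have h := congrArg (red m) (sum_jac (2 * m))
  rw [map_pow, red_qfac (by omega)] at h
  rw [map_pow, pow_succ (red m euler), ← h, map_sum, map_sum, sum_mul]
  refine sum_congr rfl fun n hn => ?_
  rcases lt_or_ge m n with hm | hm
  · have : red m (X ^ (n * (n + 1) / 2)) = 0 := red_X_pow (hm.trans_le (le_tri n))
    simp only [jac, map_mul, this]
    ring
  · have h1 : qinvSub (2 * m) n = qinv (2 * m - n) := by simp [qinvSub]; omega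
    simp only [jac, map_mul, h1, red_qfac (show m ≤ 2 * (2 * m) + 1 by omega),
      red_qinv (show m ≤ 2 * m - n by omega) he, red_qinv (show m ≤ 2 * m + n + 1 by omega) he]
    linear_combination (red m euler * red m e + 1) * (red m (2 * n + 1) * red m ((-1) ^ n) *
      red m (X ^ (n * (n + 1) / 2))) * he'

lemma coeff_euler_cube_eq_zero (n : ℕ) : coeff (5 * n + 2) (euler ^ 3) = 0 := by
  rw [red_eq_iff.1 (red_euler_cube (5 * n + 2)) _ le_rfl, map_sum]
  refine sum_eq_zero fun k _ => ?_
  have h1 : (2 * (k : ℤ⟦X⟧) + 1) * (-1) ^ k = C ((2 * (k : ℤ) + 1) * (-1) ^ k) := by simp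
  rw [h1, coeff_C_mul, coeff_X_pow, if_neg, mul_zero]
  intro h
  have h2 : k * (k + 1) / 2 * 2 = k * (k + 1) :=
    Nat.div_mul_cancel (Nat.even_mul_succ_self k).two_dvd
  rw [← h] at h2
  have h3 := congrArg (· % 5) h2
  have : k % 5 = 0 ∨ k % 5 = 1 ∨ k % 5 = 2 ∨ k % 5 = 3 ∨ k % 5 = 4 := by omega
  rcases this with h | h | h | h | h <;> simp [Nat.mul_mod, Nat.add_mod, h] at h3

/-! ### Sections modulo 5 -/

lemma nat_five_ne_zero : (5 : ℕ) ≠ 0 := by norm_num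

/-- The substitution `q ↦ q ^ 5`. -/
noncomputable abbrev ex : ℤ⟦X⟧ →ₐ[ℤ] ℤ⟦X⟧ := expand 5 nat_five_ne_zero

/-- The series `∑ₙ a (5 n + r) q ^ n` extracted from `∑ₙ a n q ^ n`. -/
noncomputable def sect (r : ℕ) : ℤ⟦X⟧ →+ ℤ⟦X⟧ where
  toFun f := mk fun n => coeff (5 * n + r) f
  map_add' f g := by ext; simp
  map_zero' := by ext; simp

lemma coeff_sect (r n : ℕ) (f : ℤ⟦X⟧) : coeff n (sect r f) = coeff (5 * n + r) f := by
  simp [sect]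

lemma sect_X_pow_mul_ex {r s : ℕ} (hr : r < 5) (hs : s < 5) (h : ℤ⟦X⟧) :
    sect r (X ^ s * ex h) = if s = r then h else 0 := by
  ext n
  rw [coeff_sect, coeff_X_pow_mul', coeff_expand]
  split_ifs with h1 h2 h3 h3 h3
  · subst h3
    congr 2
    omega
  · omega
  · omega
  · simp
  · omega
  · simp

lemma sum_sect (f : ℤ⟦X⟧) : f = ∑ s ∈ range 5, X ^ s * ex (sect s f) := by
  ext m
  have hm : m % 5 < 5 := Nat.mod_lt _ (by norm_num)
  have key : coeff (m / 5) (sect (m % 5) f) =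
      coeff (m / 5) (sect (m % 5) (∑ s ∈ range 5, X ^ s * ex (sect s f))) := by
    rw [map_sum, sum_congr rfl fun s hs => sect_X_pow_mul_ex hm (mem_range.1 hs) _]
    rw [sum_ite_eq', if_pos (mem_range.2 hm)]
  rwa [coeff_sect, coeff_sect, Nat.div_add_mod] at key

lemma sect_ex_mul {r : ℕ} (hr : r < 5) (f g : ℤ⟦X⟧) : sect r (ex f * g) = f * sect r g := by
  have h : ex f * g = ∑ s ∈ range 5, X ^ s * ex (f * sect s g) := by
    conv_lhs => rw [sum_sect g]
    rw [mul_sum]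
    refine sum_congr rfl fun s _ => ?_
    rw [map_mul]
    ring
  rw [h, map_sum, sum_congr rfl fun s hs => sect_X_pow_mul_ex hr (mem_range.1 hs) _]
  rw [sum_ite_eq', if_pos (mem_range.2 hr)]

lemma ex_injective : Function.Injective ex := by
  intro f g h
  have := congrArg (sect 0) h
  rw [← mul_one (ex f), ← mul_one (ex g), sect_ex_mul (by norm_num), sect_ex_mul (by norm_num)]
    at this
  have h1 : sect 0 (1 : ℤ⟦X⟧) = 1 := by
    have := sect_X_pow_mul_ex (r := 0) (s := 0) (by norm_num) (by norm_num) 1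
    simpa using this
  simpa [h1] using this

/-! ### The 5-dissection of the Euler product -/

lemma sect_euler_eq_zero {r : ℕ} (hr : r = 3 ∨ r = 4) : sect r euler = 0 := by
  ext n
  rw [coeff_sect, map_zero]
  refine coeff_pentagonalSeries_eq_zero ℤ ?_
  rintro ⟨k, hk⟩
  have h := two_mul_natCast_pentagonal k
  rw [hk] at h
  have h3 := congrArg (· % 5) h
  have : k % 5 = 0 ∨ k % 5 = 1 ∨ k % 5 = 2 ∨ k % 5 = 3 ∨ k % 5 = 4 := by omega
  rcases hr with rfl | rfl <;> rcases this with h | h | h | h | h <;>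
    simp [Int.mul_emod, Int.add_emod, Int.sub_emod, h] at h3

lemma sect_one_euler : sect 1 euler = - ex euler := by
  ext n
  rw [coeff_sect, map_neg, coeff_expand]
  by_cases hn : 5 * n + 1 ∈ Set.range pentagonal
  · obtain ⟨k, hk⟩ := hn
    have h := two_mul_natCast_pentagonal k
    rw [hk] at h
    have hk5 : k % 5 = 1 := by
      have h3 := congrArg (· % 5) h
      have : k % 5 = 0 ∨ k % 5 = 1 ∨ k % 5 = 2 ∨ k % 5 = 3 ∨ k % 5 = 4 := by omega
      rcases this with h | h | h | h | h <;>
        simp [Int.mul_emod, Int.add_emod, Int.sub_emod, h] at h3 ⊢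
    obtain ⟨j, rfl⟩ : ∃ j : ℤ, k = 1 - 5 * j := ⟨(1 - k) / 5, by omega⟩
    have hj := two_mul_natCast_pentagonal j
    have hn : n = 5 * pentagonal j := by
      push_cast at h
      zify
      nlinarith
    rw [← hk, coeff_pentagonalSeries_pentagonal, hn, if_pos (dvd_mul_right _ _),
      Nat.mul_div_cancel_left _ (by norm_num), coeff_pentagonalSeries_pentagonal]
    rcases Int.even_or_odd j with hj | hj
    · have : Odd (1 - 5 * j) := by
        rw [← Int.not_even_iff_odd]; intro h; rw [Int.even_sub, Int.even_mul] at h; simp [hj] at h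
      simp [Int.negOnePow_even _ hj, Int.negOnePow_odd _ this]
    · have : Even (1 - 5 * j) := by
        rw [← Int.not_even_iff_odd] at hj
        rw [Int.even_sub, Int.even_mul]; simp [hj]; decide
      simp [Int.negOnePow_odd _ hj, Int.negOnePow_even _ this]
  · rw [coeff_pentagonalSeries_eq_zero ℤ hn]
    split_ifs with h
    · rw [coeff_pentagonalSeries_eq_zero, neg_zero]
      rintro ⟨j, hj⟩
      refine hn ⟨1 - 5 * j, ?_⟩
      have h1 := two_mul_natCast_pentagonal j
      have h2 := two_mul_natCast_pentagonal (1 - 5 * j)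
      obtain ⟨d, rfl⟩ := h
      rw [hj, Nat.mul_div_cancel_left _ (by norm_num)] at h1
      zify
      nlinarith
    · simp

lemma euler_dissection :
    euler = ex (sect 0 euler) - X * ex (ex euler) + X ^ 2 * ex (sect 2 euler) := by
  conv_lhs => rw [sum_sect euler]
  simp [sum_range_succ, sect_euler_eq_zero, sect_one_euler]
  ring

lemma constantCoeff_sect_zero_euler : constantCoeff (sect 0 euler) = 1 := by
  rw [← coeff_zero_eq_constantCoeff_apply, coeff_sect]
  simpa using constantCoeff_euler

lemma sect_zero_mul_sect_two : sect 0 euler * sect 2 euler = - ex euler ^ 2 := by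
  have h : sect 2 (euler ^ 3) = 0 := by
    ext n
    rw [coeff_sect, coeff_euler_cube_eq_zero, map_zero]
  set a := sect 0 euler with ha
  set c := sect 2 euler with hc
  set b := ex euler with hb
  have h3 : euler ^ 3 = X ^ 0 * ex (a ^ 3 + X * (-3 * b * c ^ 2)) +
      X ^ 1 * ex (-3 * a ^ 2 * b + X * c ^ 3) + X ^ 2 * ex (3 * a * (a * c + b ^ 2)) +
      X ^ 3 * ex (- 6 * a * b * c - b ^ 3) + X ^ 4 * ex (3 * c * (a * c + b ^ 2)) := by
    rw [euler_dissection, ← ha, ← hc, ← hb]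
    simp only [map_add, map_mul, map_pow, map_neg, map_sub, map_ofNat, expand_X]
    ring
  rw [h3] at h
  rw [map_add, map_add, map_add, map_add, sect_X_pow_mul_ex (by norm_num) (by norm_num),
    sect_X_pow_mul_ex (by norm_num) (by norm_num), sect_X_pow_mul_ex (by norm_num) (by norm_num),
    sect_X_pow_mul_ex (by norm_num) (by norm_num), sect_X_pow_mul_ex (by norm_num) (by norm_num)]
    at h
  norm_num at h
  have ha0 : a ≠ 0 := by
    intro h0
    have := constantCoeff_sect_zero_euler
    rw [← ha, h0] at this
    simp at this
  rcases h with h | h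
  · have h3 : (3 : ℤ⟦X⟧) ≠ 0 := fun h => by
      have := congrArg constantCoeff h
      rw [map_ofNat, map_zero] at this
      norm_num at this
    simp [ha0, h3] at h
  · linear_combination h

/-! ### The norm of the Euler product -/

/-- The map `f(q) ↦ f(z q)` over the complex numbers. -/
noncomputable def twist (z : ℂ) : ℤ⟦X⟧ →+* ℂ⟦X⟧ :=
  (rescale z).comp (PowerSeries.map (Int.castRingHom ℂ))

lemma twist_X (z : ℂ) : twist z X = C z * X := by simp [twist, rescale_X]

lemma twist_ex {z : ℂ} (hz : z ^ 5 = 1) (f : ℤ⟦X⟧) : twist z (ex f) = twist 1 (ex f) := by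
  ext n
  simp only [twist, RingHom.comp_apply, coeff_rescale, coeff_map, coeff_expand]
  split_ifs with h
  · obtain ⟨k, rfl⟩ := h
    rw [pow_mul, hz]
    simp
  · simp

lemma twist_one_injective : Function.Injective (twist 1) := by
  intro f g h
  ext n
  have := congrArg (coeff n) h
  simpa [twist] using this

lemma prod_one_sub_mul {R : Type*} [CommRing R] {z : R} (hz : 1 + z + z ^ 2 + z ^ 3 + z ^ 4 = 0)
    (y : R) : (1 - y) * (1 - z * y) * (1 - z ^ 2 * y) * (1 - z ^ 3 * y) * (1 - z ^ 4 * y) =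
      1 - y ^ 5 := by
  have h5 : z ^ 5 = 1 := by linear_combination (z - 1) * hz
  have h1 : (1 - z * y) * (1 - z ^ 4 * y) = 1 - (z + z ^ 4) * y + y ^ 2 := by
    linear_combination y ^ 2 * h5
  have h2 : (1 - z ^ 2 * y) * (1 - z ^ 3 * y) = 1 - (z ^ 2 + z ^ 3) * y + y ^ 2 := by
    linear_combination y ^ 2 * h5
  have h3 : (z + z ^ 4) * (z ^ 2 + z ^ 3) = -1 := by
    linear_combination hz + (z + z ^ 2) * h5
  calc _ = (1 - y) * ((1 - z * y) * (1 - z ^ 4 * y)) * ((1 - z ^ 2 * y) * (1 - z ^ 3 * y)) := by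
        ring
    _ = 1 - y ^ 5 := by
        rw [h1, h2]
        linear_combination (1 - y) * (y ^ 2 * h3 - (y + y ^ 3) * hz)

lemma prod_trinomial {R : Type*} [CommRing R] {z : R} (hz : 1 + z + z ^ 2 + z ^ 3 + z ^ 4 = 0)
    (a b c : R) (hac : a * c = - b ^ 2) :
    (a + b + c) * (a + z * b + z ^ 2 * c) * (a + z ^ 2 * b + (z ^ 2) ^ 2 * c) *
      (a + z ^ 3 * b + (z ^ 3) ^ 2 * c) * (a + z ^ 4 * b + (z ^ 4) ^ 2 * c) =
      a ^ 5 + 11 * b ^ 5 + c ^ 5 := by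
  have h5 : z ^ 5 = 1 := by linear_combination (z - 1) * hz
  have h1 : (a + z * b + z ^ 2 * c) * (a + z ^ 4 * b + (z ^ 4) ^ 2 * c) =
      a ^ 2 + b ^ 2 + c ^ 2 + (z + z ^ 4) * (a * b + b * c) + (z ^ 2 + z ^ 3) * (a * c) := by
    linear_combination (z ^ 3 * a * c + b ^ 2 + (z ^ 5 + 1) * c ^ 2 + (z + z ^ 4) * b * c) * h5
  have h2 : (a + z ^ 2 * b + (z ^ 2) ^ 2 * c) * (a + z ^ 3 * b + (z ^ 3) ^ 2 * c) =
      a ^ 2 + b ^ 2 + c ^ 2 + (z ^ 2 + z ^ 3) * (a * b + b * c) + (z + z ^ 4) * (a * c) := by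
    linear_combination (z * a * c + b ^ 2 + (z ^ 5 + 1) * c ^ 2 + (z ^ 2 + z ^ 3) * b * c) * h5
  have h3 : (z + z ^ 4) * (z ^ 2 + z ^ 3) = -1 := by
    linear_combination hz + (z + z ^ 2) * h5
  have h4 : z ^ 2 + z ^ 3 = -1 - (z + z ^ 4) := by linear_combination hz
  rw [h4] at h1 h2 h3
  generalize z + z ^ 4 = p at *
  have e : (a ^ 2 + b ^ 2 + c ^ 2 + p * (a * b + b * c) + (-1 - p) * (a * c)) *
      (a ^ 2 + b ^ 2 + c ^ 2 + (-1 - p) * (a * b + b * c) + p * (a * c)) =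
      (a ^ 2 + b ^ 2 + c ^ 2) ^ 2 - (a ^ 2 + b ^ 2 + c ^ 2) * (a * b + b * c + a * c)
      - (a * b + b * c) ^ 2 - (a * c) ^ 2 + 3 * (a * b + b * c) * (a * c) := by
    linear_combination ((a * b + b * c) ^ 2 + (a * c) ^ 2 - 2 * (a * b + b * c) * (a * c)) * h3
  calc _ = (a + b + c) * ((a + z * b + z ^ 2 * c) * (a + z ^ 4 * b + (z ^ 4) ^ 2 * c)) *
      ((a + z ^ 2 * b + (z ^ 2) ^ 2 * c) * (a + z ^ 3 * b + (z ^ 3) ^ 2 * c)) := by ring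
    _ = a ^ 5 + 11 * b ^ 5 + c ^ 5 := by
      rw [h1, h2, mul_assoc, e]
      linear_combination (5 * b * (a * c - b ^ 2) - 5 * b ^ 3) * hac

lemma twist_one_sub_X_pow (z : ℂ) (i : ℕ) :
    twist z (1 - X ^ i) = 1 - C z ^ i * X ^ i := by
  rw [map_sub, map_one, map_pow, twist_X, mul_pow]

lemma sum_root_pow {z : ℂ} (hz : IsPrimitiveRoot z 5) :
    1 + C z + C z ^ 2 + C z ^ 3 + C z ^ 4 = (0 : ℂ⟦X⟧) := by
  have h := hz.geom_sum_eq_zero (by norm_num)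
  have := congrArg (C (R := ℂ)) h
  simpa [sum_range_succ] using this

lemma prod_twist_qfac {z : ℂ} (hz : IsPrimitiveRoot z 5) (N : ℕ) :
    (∏ k ∈ range 5, twist (z ^ k) (qfac (5 * N))) * twist 1 (ex (ex (qfac N))) =
      twist 1 (ex (qfac (5 * N)) * ex (qfac N) ^ 5) := by
  induction N with
  | zero => simp [qfac]
  | succ N ih =>
    have h5 : C z ^ 5 = (1 : ℂ⟦X⟧) := by rw [← map_pow, hz.pow_eq_one, map_one]
    have e : qfac (5 * (N + 1)) = qfac (5 * N) * ((1 - X ^ (5 * N + 1)) * (1 - X ^ (5 * N + 2)) *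
        (1 - X ^ (5 * N + 3)) * (1 - X ^ (5 * N + 4)) * (1 - X ^ (5 * N + 5))) := by
      rw [show 5 * (N + 1) = 5 * N + 1 + 1 + 1 + 1 + 1 by ring]
      simp only [qfac_succ]
      ring
    have key (j : ℕ) (y : ℂ⟦X⟧) (hj : j = 1 ∨ j = 2 ∨ j = 3 ∨ j = 4) :
        ∏ k ∈ range 5, (1 - C (z ^ k) ^ (5 * N + j) * y) = 1 - y ^ 5 := by
      have hp : IsPrimitiveRoot (z ^ j) 5 :=
        hz.pow_of_coprime j (by rcases hj with rfl | rfl | rfl | rfl <;> decide)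
      rw [← prod_one_sub_mul (sum_root_pow hp) y]
      have (k : ℕ) : C (z ^ k) ^ (5 * N + j) = (C (z ^ j) ^ k : ℂ⟦X⟧) := by
        rw [map_pow, map_pow, ← pow_mul, ← pow_mul, mul_add, pow_add, mul_comm k (5 * N),
          mul_assoc, pow_mul, h5, one_pow, one_mul, mul_comm]
      simp only [prod_range_succ, prod_range_zero, this]
      ring
    have key5 (y : ℂ⟦X⟧) : ∏ k ∈ range 5, (1 - C (z ^ k) ^ (5 * N + 5) * y) = (1 - y) ^ 5 := by
      have (k : ℕ) : C (z ^ k) ^ (5 * N + 5) = (1 : ℂ⟦X⟧) := by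
        rw [map_pow, ← pow_mul, show k * (5 * N + 5) = 5 * (k * (N + 1)) by ring, pow_mul, h5,
          one_pow]
      simp only [this, one_mul, prod_const, card_range]
    rw [e, qfac_succ]
    simp only [map_mul, twist_one_sub_X_pow, prod_mul_distrib] at ih ⊢
    rw [key 1 _ (by simp), key 2 _ (by simp), key 3 _ (by simp), key 4 _ (by simp), key5]
    simp only [map_mul, map_sub, map_one, map_pow, expand_X, twist_X, one_mul] at ih ⊢
    linear_combination (1 - (X ^ (5 * N + 1)) ^ 5) * (1 - (X ^ (5 * N + 2)) ^ 5) *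
      (1 - (X ^ (5 * N + 3)) ^ 5) * (1 - (X ^ (5 * N + 4)) ^ 5) * (1 - (X ^ (5 * N + 5))) ^ 5 *
      (1 - X ^ (25 * (N + 1))) * ih

lemma congr_of_red {φ : ℤ⟦X⟧ →+* ℂ⟦X⟧} (hφ : X ∣ φ X) {m : ℕ} {f g : ℤ⟦X⟧}
    (h : red m f = red m g) :
    Ideal.Quotient.mk (Ideal.span {(X : ℂ⟦X⟧) ^ (m + 1)}) (φ f) =
      Ideal.Quotient.mk (Ideal.span {(X : ℂ⟦X⟧) ^ (m + 1)}) (φ g) := by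
  rw [Ideal.Quotient.eq, Ideal.mem_span_singleton] at h ⊢
  rw [← map_sub]
  refine (pow_dvd_pow_of_dvd hφ _).trans ?_
  rw [← map_pow]
  exact map_dvd φ h

lemma prod_twist_euler {z : ℂ} (hz : IsPrimitiveRoot z 5) :
    (∏ k ∈ range 5, twist (z ^ k) euler) * twist 1 (ex (ex euler)) =
      twist 1 (ex euler ^ 6) := by
  ext m
  have hX (w : ℂ) : X ∣ twist w X := by rw [twist_X]; exact dvd_mul_left _ _
  have hX1 : X ∣ ((twist 1).comp ex.toRingHom) X := by
    simp [twist_X]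
  have hX2 : X ∣ ((twist 1).comp (ex.toRingHom.comp ex.toRingHom)) X := by
    simp only [RingHom.comp_apply, AlgHom.toRingHom_eq_coe, RingHom.coe_coe, expand_X, map_pow,
      twist_X, map_one, one_mul, ← pow_mul]
    exact dvd_pow_self _ (by norm_num)
  have h := congrArg (Ideal.Quotient.mk (Ideal.span {(X : ℂ⟦X⟧) ^ (m + 1)}))
    (prod_twist_qfac hz m)
  have r0 (w : ℂ) := congr_of_red (hX w) (red_qfac (show m ≤ 5 * m by omega))
  have r1 := congr_of_red hX1 (red_qfac (show m ≤ 5 * m by omega))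
  have r1' := congr_of_red hX1 (red_qfac (le_refl m))
  have r2 := congr_of_red hX2 (red_qfac (le_refl m))
  simp only [RingHom.comp_apply, AlgHom.toRingHom_eq_coe, RingHom.coe_coe] at r1 r1' r2
  simp only [map_mul, map_prod, map_pow, r0, r1, r1', r2] at h
  have h' : Ideal.Quotient.mk (Ideal.span {(X : ℂ⟦X⟧) ^ (m + 1)})
      ((∏ k ∈ range 5, twist (z ^ k) euler) * twist 1 (ex (ex euler))) =
      Ideal.Quotient.mk (Ideal.span {(X : ℂ⟦X⟧) ^ (m + 1)}) (twist 1 (ex euler ^ 6)) := by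
    simp only [map_mul, map_prod, map_pow, h]
    ring
  rw [Ideal.Quotient.eq, Ideal.mem_span_singleton, X_pow_dvd_iff] at h'
  have := h' m (Nat.lt_succ_self m)
  rwa [map_sub, sub_eq_zero] at this

lemma twist_euler {z : ℂ} (hz : z ^ 5 = 1) :
    twist z euler = twist 1 (ex (sect 0 euler)) + C z * twist 1 (- (X * ex (ex euler))) +
      C z ^ 2 * twist 1 (X ^ 2 * ex (sect 2 euler)) := by
  conv_lhs => rw [euler_dissection]
  simp only [map_add, map_sub, map_mul, map_neg, map_pow, twist_X, twist_ex hz, map_one, one_mul]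
  ring

lemma euler_norm :
    ex (ex euler) * (ex (sect 0 euler) ^ 5 + 11 * (- (X * ex (ex euler))) ^ 5 +
      (X ^ 2 * ex (sect 2 euler)) ^ 5) = ex euler ^ 6 := by
  have hz := Complex.isPrimitiveRoot_exp 5 (by norm_num)
  set z := Complex.exp (2 * Real.pi * Complex.I / (5 : ℕ))
  apply twist_one_injective
  rw [← prod_twist_euler hz]
  have hac : ex (sect 0 euler) * (X ^ 2 * ex (sect 2 euler)) = - (- (X * ex (ex euler))) ^ 2 := by
    have := congrArg ex sect_zero_mul_sect_two
    simp only [map_mul, map_neg, map_pow] at this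
    linear_combination X ^ 2 * this
  have hac' := congrArg (twist 1) hac
  rw [map_mul, map_neg, map_pow] at hac'
  have h := prod_trinomial (sum_root_pow hz) _ _ _ hac'
  have hk (k : ℕ) := twist_euler (show (z ^ k) ^ 5 = 1 by
    rw [← pow_mul, mul_comm, pow_mul, hz.pow_eq_one, one_pow])
  simp only [hk, prod_range_succ, prod_range_zero, map_mul (twist 1) (ex (ex euler))]
  rw [map_add, map_add, map_mul, map_pow, map_pow, map_pow, map_ofNat, ← h]
  simp only [map_pow]
  ring

/-! ### Congruences for the generating function of 5-cores -/

lemma sect_sum_five {r : ℕ} (hr : r < 5) (h : ℕ → ℤ⟦X⟧) :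
    sect r (∑ s ∈ range 5, X ^ s * ex (h s)) = h r := by
  rw [map_sum, sum_congr rfl fun s hs => sect_X_pow_mul_ex hr (mem_range.1 hs) _,
    sum_ite_eq', if_pos (mem_range.2 hr)]

lemma exists_param : ∃ u : ℤ⟦X⟧, sect 0 euler * u = - ex euler ∧
    euler = ex (sect 0 euler) * (1 + X * ex u - (X * ex u) ^ 2) := by
  obtain ⟨v, hv⟩ : ∃ v : ℤ⟦X⟧, sect 0 euler * v = 1 :=
    ⟨_, mul_invOfUnit _ 1 (by simp [constantCoeff_sect_zero_euler])⟩
  have h1 : sect 0 euler * (- ex euler * v) = - ex euler := by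
    linear_combination (- ex euler) * hv
  have h2 : sect 2 euler = - (sect 0 euler * (- ex euler * v) ^ 2) := by
    linear_combination (ex euler ^ 2 * v - sect 2 euler) * hv + v * sect_zero_mul_sect_two
  refine ⟨- ex euler * v, h1, ?_⟩
  conv_lhs => rw [euler_dissection, h2]
  have h1' := congrArg ex h1
  simp only [map_mul, map_neg, map_pow] at h1' ⊢
  linear_combination -X * h1'

lemma euler_ne_zero : euler ≠ 0 := by
  intro h
  have := constantCoeff_euler
  rw [h] at this
  simp at this

lemma dvd_sect_four_euler_pow : (3125 : ℤ⟦X⟧) ∣ sect 4 (euler ^ 14) := by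
  obtain ⟨u, hu, h⟩ := exists_param
  set a := sect 0 euler
  set w := X * u ^ 5 with hw
  have key : euler ^ 14 = ex (a ^ 14) * ∑ s ∈ range 5, X ^ s * ex
      ((fun s : ℕ => if s = 0 then 1 - 910 * w - 10010 * w ^ 2 - 6930 * w ^ 3 + 5005 * w ^ 4
          - 182 * w ^ 5
        else if s = 1 then u * (14 - 1365 * w - 3640 * w ^ 2 + 14105 * w ^ 3 - 1430 * w ^ 4
          + 77 * w ^ 5)
        else if s = 2 then u ^ 2 * (77 + 1430 * w + 14105 * w ^ 2 + 3640 * w ^ 3 - 1365 * w ^ 4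
          - 14 * w ^ 5)
        else if s = 3 then u ^ 3 * (182 + 5005 * w + 6930 * w ^ 2 - 10010 * w ^ 3 + 910 * w ^ 4
          + w ^ 5)
        else -15625 * u ^ 4 * w ^ 2) s) := by
    rw [h, mul_pow]
    simp [sum_range_succ, hw, map_ofNat, -mul_eq_mul_left_iff]
    ring
  rw [key, sect_ex_mul (by norm_num), sect_sum_five (by norm_num)]
  exact ⟨a ^ 14 * (-5 * u ^ 4 * w ^ 2), by norm_num; ring⟩

lemma dvd_sect_three_euler_pow : (125 : ℤ⟦X⟧) ∣ sect 3 (euler ^ 8) := by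
  obtain ⟨u, hu, h⟩ := exists_param
  set a := sect 0 euler
  set w := X * u ^ 5 with hw
  have key : euler ^ 8 = ex (a ^ 8) * ∑ s ∈ range 5, X ^ s * ex
      ((fun s : ℕ => if s = 0 then 1 - 56 * w + 112 * w ^ 2 - 8 * w ^ 3
        else if s = 1 then u * (8 + 112 * w + 56 * w ^ 2 + w ^ 3)
        else if s = 2 then u ^ 2 * (20 + 120 * w - 70 * w ^ 2)
        else if s = 3 then -125 * u ^ 3 * w
        else u ^ 4 * (-70 - 120 * w + 20 * w ^ 2)) s) := by
    rw [h, mul_pow]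
    simp [sum_range_succ, hw, map_ofNat, -mul_eq_mul_left_iff]
    ring
  rw [key, sect_ex_mul (by norm_num), sect_sum_five (by norm_num)]
  exact ⟨a ^ 8 * (- u ^ 3 * w), by norm_num; ring⟩

lemma dvd_sect_sect {g : ℤ⟦X⟧} (hg : g * euler = ex euler ^ 5) :
    (3125 : ℤ⟦X⟧) ∣ sect 4 (sect 1 (g ^ 4)) := by
  obtain ⟨u, hu, h⟩ := exists_param
  set a := sect 0 euler with ha
  set w := X * u ^ 5 with hw
  set p : ℤ⟦X⟧ → ℤ⟦X⟧ := fun t =>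
    1 - t + 2 * t ^ 2 - 3 * t ^ 3 + 5 * t ^ 4 + 3 * t ^ 5 + 2 * t ^ 6 + t ^ 7 + t ^ 8 with hp
  set N := a ^ 5 * (1 + 11 * w - w ^ 2) with hN
  have hu' := congrArg ex hu
  rw [map_mul, map_neg] at hu'
  have hc : X ^ 2 * ex (sect 2 euler) = - ex a * (X * ex u) ^ 2 := by
    have h1 := euler_dissection
    rw [← ha] at h1
    linear_combination h - h1 + X * hu'
  have hnorm : ex euler * N = euler ^ 6 := by
    apply ex_injective
    rw [map_mul, map_pow, ← euler_norm, hc, ← ha,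
      show - (X * ex (ex euler)) = ex a * (X * ex u) by linear_combination - X * hu']
    simp only [hN, hw, map_mul, map_add, map_sub, map_pow, map_one, map_ofNat, expand_X]
    ring
  have hgp : g * ex euler = ex (ex euler) * (ex a ^ 4 * p (X * ex u)) := by
    apply mul_right_cancel₀ euler_ne_zero
    have h1 := congrArg ex hnorm
    rw [map_mul, map_pow] at h1
    have h2 : euler * (ex a ^ 4 * p (X * ex u)) = ex N := by
      conv_lhs => rw [h]
      simp only [hN, hw, hp, map_mul, map_add, map_sub, map_pow, map_one, map_ofNat, expand_X]
      ring
    linear_combination ex euler * hg - h1 - ex (ex euler) * h2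
  have key : ex (euler ^ 4) * g ^ 4 = ex (ex euler ^ 4 * a ^ 16) * ∑ s ∈ range 5, X ^ s * ex
      ((fun s : ℕ => if s = 0 then 1 - 212 * w + 1860 * w ^ 2 - 60 * w ^ 3 + 1815 * w ^ 4
          + 708 * w ^ 5 + 14 * w ^ 6
        else if s = 1 then u * (-4 + 418 * w - 1840 * w ^ 2 + 1015 * w ^ 3 + 1840 * w ^ 4
          + 418 * w ^ 5 + 4 * w ^ 6)
        else if s = 2 then u ^ 2 * (14 - 708 * w + 1815 * w ^ 2 + 60 * w ^ 3 + 1860 * w ^ 4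
          + 212 * w ^ 5 + w ^ 6)
        else if s = 3 then u ^ 3 * (-40 + 1100 * w - 1200 * w ^ 2 + 1500 * w ^ 3 + 1400 * w ^ 4
          + 105 * w ^ 5)
        else u ^ 4 * (105 - 1400 * w + 1500 * w ^ 2 + 1200 * w ^ 3 + 1100 * w ^ 4
          + 40 * w ^ 5)) s) := by
    rw [map_pow, mul_comm, ← mul_pow, hgp]
    simp [sum_range_succ, hw, hp, map_ofNat, -mul_eq_mul_left_iff]
    ring
  have key2 := congrArg (sect 1) key
  rw [sect_ex_mul (by norm_num), sect_ex_mul (by norm_num), sect_sum_five (by norm_num)] at key2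
  norm_num at key2
  obtain ⟨e, he⟩ := exists_euler_inv
  have key3 : euler ^ 4 * sect 1 (g ^ 4) = euler ^ 4 * (4 * ex euler ^ 2 * euler ^ 14 +
      550 * (X * (ex euler ^ 8 * euler ^ 8)) + 3125 * (4 * X ^ 2 * ex euler ^ 14 * euler ^ 2 +
        25 * X ^ 3 * ex euler ^ 20 * e ^ 4)) := by
    have h1 : ex euler ^ 4 * a ^ 16 * (u * (-4 + 418 * w - 1840 * w ^ 2 + 1015 * w ^ 3
        + 1840 * w ^ 4 + 418 * w ^ 5 + 4 * w ^ 6)) = ex euler ^ 4 * (-4 * (a * u) * N ^ 3 +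
        550 * X * (a * u) ^ 6 * N ^ 2 - 12500 * X ^ 2 * (a * u) ^ 11 * N +
        78125 * X ^ 3 * (a * u) ^ 16) := by
      simp only [hN, hw]
      ring
    have h2 : euler ^ 4 * e ^ 4 = 1 := by rw [← mul_pow, he, one_pow]
    rw [key2, h1, hu]
    have h3 : ex euler ^ 4 * (-4 * (-ex euler) * N ^ 3 +
        550 * X * (-ex euler) ^ 6 * N ^ 2 - 12500 * X ^ 2 * (-ex euler) ^ 11 * N +
        78125 * X ^ 3 * (-ex euler) ^ 16) = 4 * ex euler ^ 2 * (ex euler * N) ^ 3 +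
        550 * X * ex euler ^ 8 * (ex euler * N) ^ 2 + 12500 * X ^ 2 * ex euler ^ 14 *
        (ex euler * N) + 78125 * X ^ 3 * ex euler ^ 20 := by ring
    rw [h3, hnorm]
    linear_combination (- 78125 * X ^ 3 * ex euler ^ 20) * h2
  have key4 := mul_left_cancel₀ (pow_ne_zero 4 euler_ne_zero) key3
  have hC (k : ℕ) (f : ℤ⟦X⟧) (r : ℕ) : sect r ((k : ℤ⟦X⟧) * f) = k * sect r f := by
    rw [← nsmul_eq_mul, ← nsmul_eq_mul, map_nsmul]
  have hX (f : ℤ⟦X⟧) : sect 4 (X * f) = sect 3 f := by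
    ext n
    rw [coeff_sect, coeff_sect, coeff_succ_X_mul]
  rw [key4, map_add, map_add, mul_assoc, ← map_pow, ← map_pow ex euler 8]
  have c1 := hC 4 (ex (euler ^ 2) * euler ^ 14) 4
  have c2 := hC 550 (X * (ex (euler ^ 8) * euler ^ 8)) 4
  have c3 := fun f => hC 3125 f 4
  push_cast at c1 c2 c3
  rw [c1, c2, c3, hX, sect_ex_mul (by norm_num), sect_ex_mul (by norm_num)]
  obtain ⟨x, hx⟩ := dvd_sect_four_euler_pow
  obtain ⟨y, hy⟩ := dvd_sect_three_euler_pow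
  rw [hx, hy]
  exact dvd_add (dvd_add ⟨4 * euler ^ 2 * x, by ring⟩ ⟨22 * euler ^ 8 * y, by ring⟩)
    (dvd_mul_right _ _)

lemma dvd_ex_sub_pow (f : ℤ⟦X⟧) : (5 : ℤ⟦X⟧) ∣ f ^ 5 - ex f := by
  have : Fact (Nat.Prime 5) := ⟨by norm_num⟩
  have h : PowerSeries.map (Int.castRingHom (ZMod 5)) (f ^ 5 - ex f) = 0 := by
    rw [map_sub, map_pow, sub_eq_zero, PowerSeries.map_expand]
    have := MvPowerSeries.map_frobenius_expand 5 nat_five_ne_zero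
      (f := PowerSeries.map (Int.castRingHom (ZMod 5)) f)
    rw [ZMod.frobenius_zmod] at this
    exact this.symm
  refine ⟨mk fun n => coeff n (f ^ 5 - ex f) / 5, ?_⟩
  ext n
  have h1 := congrArg (coeff n) h
  rw [coeff_map, map_zero, Int.coe_castRingHom, ZMod.intCast_zmod_eq_zero_iff_dvd] at h1
  rw [show (5 : ℤ⟦X⟧) = C 5 by simp, coeff_C_mul, coeff_mk,
    Int.mul_ediv_cancel' (by exact_mod_cast h1)]


lemma dvd_ex_ex_sub_pow (f : ℤ⟦X⟧) : (3125 : ℤ⟦X⟧) ∣ f ^ 15625 - ex (ex (f ^ 625)) := by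
  have h1 : (5 : ℤ⟦X⟧) ∣ f ^ 25 - ex (ex f) := by
    have h2 := (dvd_ex_sub_pow f).trans (sub_dvd_pow_sub_pow (f ^ 5) (ex f) 5)
    have h3 := dvd_ex_sub_pow (ex f)
    have := dvd_add h2 h3
    rwa [← pow_mul, sub_add_sub_cancel] at this
  have h2 : ((5 : ℕ) : ℤ⟦X⟧) ∣ f ^ 25 - ex (ex f) := by exact_mod_cast h1
  have h3 := dvd_sub_pow_of_dvd_sub h2 4
  rw [← pow_mul] at h3
  norm_num at h3
  rw [map_pow, map_pow]
  exact h3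

lemma dvd_sect_sect_pow {g : ℤ⟦X⟧} (hg : g * euler = ex euler ^ 5) (i : ℕ) :
    (3125 : ℤ⟦X⟧) ∣ sect 4 (sect 1 (g ^ (15625 * i + 4))) := by
  obtain ⟨x, hx⟩ := dvd_ex_ex_sub_pow (g ^ i)
  have h : g ^ (15625 * i + 4) = ex (ex ((g ^ i) ^ 625)) * g ^ 4 + (3125 : ℕ) • (x * g ^ 4) := by
    rw [pow_add, mul_comm 15625, pow_mul, nsmul_eq_mul]
    push_cast
    linear_combination g ^ 4 * hx
  rw [h, map_add, map_add, map_nsmul, map_nsmul, sect_ex_mul (by norm_num),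
    sect_ex_mul (by norm_num), nsmul_eq_mul]
  exact dvd_add ((dvd_sect_sect hg).mul_left _) (by push_cast; exact dvd_mul_right _ _)

lemma dvd_coeff_pow {g : ℤ⟦X⟧} (hg : g * euler = ex euler ^ 5) (i n : ℕ) :
    (3125 : ℤ) ∣ coeff (25 * n + 21) (g ^ (15625 * i + 4)) := by
  obtain ⟨x, hx⟩ := dvd_sect_sect_pow hg i
  have h := congrArg (coeff n) hx
  rw [coeff_sect, coeff_sect, show 5 * (5 * n + 4) + 1 = 25 * n + 21 by ring,
    show (3125 : ℤ⟦X⟧) = C 3125 by simp, coeff_C_mul] at h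
  exact ⟨_, h⟩

/-! ### Tuples of cores -/

/-- The generating function of `t`-core partitions. -/
noncomputable def coreSeries (t : ℕ) : ℤ⟦X⟧ :=
  mk fun m => (Nat.card {p : m.Partition // IsTCore t p} : ℤ)

lemma numA_eq_coeff (t k n : ℕ) : (numA t k n : ℤ) = coeff n (coreSeries t ^ k) := by
  classical
  set S : Finset (Σ m : Fin (n + 1), Nat.Partition (m : ℕ)) :=
    (univ : Finset (Fin (n + 1))).sigma fun m => univ.filter fun p => IsTCore t p with hS
  have h1 : red n (∑ x ∈ S, X ^ (x.1 : ℕ)) = red n (coreSeries t) := by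
    refine red_eq_iff.2 fun j hj => ?_
    rw [hS, sum_sigma]
    simp only [sum_const, map_sum, map_nsmul, coeff_X_pow]
    rw [sum_eq_single (⟨j, by omega⟩ : Fin (n + 1))]
    · simp [coreSeries, Nat.card_eq_fintype_card, Fintype.card_subtype]
    · intro b _ hb
      rw [if_neg (fun h => hb (Fin.ext h.symm)), smul_zero]
    · simp
  have h2 : red n ((∑ x ∈ S, X ^ (x.1 : ℕ)) ^ k) = red n (coreSeries t ^ k) := by
    rw [map_pow, map_pow, h1]
  rw [← red_eq_iff.1 h2 n le_rfl]
  have h3 : (∑ x ∈ S, (X : ℤ⟦X⟧) ^ (x.1 : ℕ)) ^ k =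
      ∑ f ∈ Fintype.piFinset fun _ : Fin k => S, X ^ (∑ i, ((f i).1 : ℕ)) := by
    simp only [← prod_pow_eq_pow_sum]
    rw [← prod_univ_sum (fun _ : Fin k => S) (fun _ x => (X : ℤ⟦X⟧) ^ (x.1 : ℕ))]
    simp
  rw [h3, map_sum]
  simp only [coeff_X_pow]
  rw [sum_boole, numA, Nat.card_eq_fintype_card, Fintype.card_subtype]
  congr 2
  ext f
  simp [hS, eq_comm, and_comm]

/-! ### The product formula for abacus counts -/

/-- The coefficients of `∏_{i ≥ 0} (1 + z q ^ i)` as a series in `z`. -/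
noncomputable def prodCoeff (k : ℕ) : ℤ⟦X⟧ := X ^ k.choose 2 * qinv k

lemma prodCoeff_succ (k : ℕ) : prodCoeff (k + 1) * (1 - X ^ (k + 1)) = X ^ k * prodCoeff k := by
  rw [prodCoeff, prodCoeff, mul_assoc, qinv_succ, Nat.choose_succ_succ' k 1, Nat.choose_one_right]
  ring

lemma prodCoeff_zero : prodCoeff 0 = 1 := by
  have := qfac_mul_qinv 0
  simpa [prodCoeff, qfac] using this

lemma one_sub_X_pow_ne_zero (k : ℕ) : (1 - X ^ (k + 1) : ℤ⟦X⟧) ≠ 0 := by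
  intro h
  have := congrArg constantCoeff h
  simp at this

lemma eq_prodCoeff {H : ℤ⟦X⟧⟦X⟧} (h0 : coeff 0 H = 1)
    (h : H = (1 + X) * rescale X H) (k : ℕ) : coeff k H = prodCoeff k := by
  induction k with
  | zero => rw [h0, prodCoeff_zero]
  | succ k ih =>
    apply mul_right_cancel₀ (one_sub_X_pow_ne_zero k)
    rw [prodCoeff_succ, ← ih]
    have := congrArg (coeff (k + 1)) h
    rw [add_mul, one_mul, map_add, coeff_succ_X_mul, coeff_rescale, coeff_rescale] at this
    linear_combination this

lemma mk_ex_prodCoeff : (mk fun k => ex (prodCoeff k) : ℤ⟦X⟧⟦X⟧) =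
    (1 + X) * rescale (X ^ 5) (mk fun k => ex (prodCoeff k)) := by
  ext1 k
  rcases k with _ | k
  · rw [PowerSeries.coeff_mul, Nat.antidiagonal_zero, sum_singleton, coeff_rescale]
    simp [prodCoeff_zero]
  · have h := congrArg ex (prodCoeff_succ k)
    simp only [map_mul, map_sub, map_one, map_pow, expand_X] at h
    rw [add_mul, one_mul, map_add, coeff_succ_X_mul, coeff_rescale, coeff_rescale, coeff_mk,
      coeff_mk]
    linear_combination h

lemma prodCoeff_eq_sum (N : ℕ) : prodCoeff N = ∑ k ∈ piAntidiag (univ : Finset (Fin 5)) N,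
    ∏ r : Fin 5, ((X ^ (r : ℕ)) ^ k r * ex (prodCoeff (k r))) := by
  set F : ℤ⟦X⟧⟦X⟧ := mk fun k => ex (prodCoeff k) with hF
  have h := eq_prodCoeff (H := ∏ r : Fin 5, rescale (X ^ (r : ℕ)) F) ?_ ?_ N
  · rw [← h, PowerSeries.coeff_prod]
    refine sum_bij (fun l _ => l) ?_ ?_ ?_ ?_
    · intro l hl
      simpa using hl
    · intro l _ l' _ h
      exact DFunLike.coe_injective h
    · intro k hk
      refine ⟨Finsupp.equivFunOnFinite.symm k, by simpa using hk, by simp⟩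
    · intro l _
      simp [hF, coeff_rescale]
  · rw [coeff_zero_eq_constantCoeff_apply, map_prod]
    simp [hF, ← coeff_zero_eq_constantCoeff_apply, coeff_rescale, prodCoeff_zero]
  · rw [map_prod]
    simp only [rescale_rescale, Fin.prod_univ_five]
    have h0 : rescale (X ^ ((0 : Fin 5) : ℕ)) F = (1 + X) * rescale (X ^ 5) F := by
      conv_rhs => rw [← mk_ex_prodCoeff]
      simp [hF]
    rw [h0]
    simp only [← pow_succ]
    norm_num
    ring

/-- The sum of the elements of the abacus with `k r` beads on runner `r`, for five runners. -/
def abacusSum (k : Fin 5 → ℕ) : ℕ := ∑ r : Fin 5, (r * k r + 5 * (k r).choose 2)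

lemma two_mul_choose_two (n : ℕ) : 2 * (n.choose 2 : ℤ) = n * (n - 1) := by
  have h := Nat.div_mul_cancel (Nat.even_mul_pred_self n).two_dvd
  rw [← Nat.choose_two_right] at h
  rcases n with _ | n
  · rfl
  · zify at h
    push_cast at h ⊢
    linarith

lemma two_mul_abacusSum {k : Fin 5 → ℕ} {M : ℕ} (hk : ∑ r, k r = 5 * M) :
    2 * (abacusSum k : ℤ) = 5 * M * (5 * M - 1) +
      ∑ r : Fin 5, (5 * ((k r : ℤ) - M) ^ 2 + (2 * r - 4) * (k r - M)) := by
  have h (r : Fin 5) := two_mul_choose_two (k r)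
  have hk' : ((∑ r, k r : ℕ) : ℤ) = 5 * M := by rw [hk]; push_cast; rfl
  push_cast [Fin.sum_univ_five] at hk'
  simp only [abacusSum, Fin.sum_univ_five] at *
  push_cast
  have e2 : ((2 : Fin 5) : ℕ) = 2 := rfl
  have e3 : ((3 : Fin 5) : ℕ) = 3 := rfl
  have e4 : ((4 : Fin 5) : ℕ) = 4 := rfl
  simp only [Fin.val_zero, Fin.val_one, e2, e3, e4, Nat.cast_zero, Nat.cast_one, Nat.cast_ofNat]
  linear_combination 5 * h 0 + 5 * h 1 + 5 * h 2 + 5 * h 3 + 5 * h 4 + (10 * M - 1) * hk'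

lemma sq_le_of_abacusSum {k : Fin 5 → ℕ} {M : ℕ} (hk : ∑ r, k r = 5 * M) (r : Fin 5) :
    5 * M * (5 * M - 1) + ((k r : ℤ) - M) ^ 2 ≤ 2 * (abacusSum k : ℤ) := by
  rw [two_mul_abacusSum hk]
  have key (s : Fin 5) : ((k s : ℤ) - M) ^ 2 ≤
      5 * ((k s : ℤ) - M) ^ 2 + (2 * s - 4) * (k s - M) := by
    have h4 : (s : ℤ) ≤ 4 := by have := s.2; omega
    have h0 : 0 ≤ (s : ℤ) := by positivity
    generalize (k s : ℤ) - M = c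
    have h1 := Int.le_self_sq c
    have h2 := Int.le_self_sq (-c)
    nlinarith
  have h := sum_le_sum fun s (_ : s ∈ univ) => key s
  have := single_le_sum (f := fun s => ((k s : ℤ) - M) ^ 2) (fun s _ => sq_nonneg _) (mem_univ r)
  linarith

lemma red_ex {m : ℕ} {f g : ℤ⟦X⟧} (h : red m f = red m g) : red m (ex f) = red m (ex g) := by
  rw [red_eq_iff] at h ⊢
  intro i hi
  rw [coeff_expand, coeff_expand, h _ ((Nat.div_le_self _ _).trans hi)]

lemma choose_two_le_abacusSum {k : Fin 5 → ℕ} {M : ℕ} (hk : ∑ r, k r = 5 * M) :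
    (5 * M).choose 2 ≤ abacusSum k := by
  have h := sq_le_of_abacusSum hk 0
  have h2 := two_mul_choose_two (5 * M)
  push_cast at h2
  zify
  nlinarith [sq_nonneg ((k 0 : ℤ) - M)]

lemma qinv_eq_sum (M : ℕ) : qinv (5 * M) = ∑ k ∈ piAntidiag (univ : Finset (Fin 5)) (5 * M),
    X ^ (abacusSum k - (5 * M).choose 2) * ∏ r, ex (qinv (k r)) := by
  apply mul_left_cancel₀ (pow_ne_zero (Nat.choose (5 * M) 2) (X_ne_zero (R := ℤ)))
  have h := prodCoeff_eq_sum (5 * M)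
  rw [prodCoeff] at h
  rw [h, mul_sum]
  refine sum_congr rfl fun k hk => ?_
  have hk' : ∑ r, k r = 5 * M := by simpa using hk
  rw [← mul_assoc, ← pow_add, Nat.add_sub_cancel' (choose_two_le_abacusSum hk'), abacusSum,
    ← prod_pow_eq_pow_sum, ← prod_mul_distrib]
  refine prod_congr rfl fun r _ => ?_
  rw [prodCoeff, map_mul, map_pow, expand_X, pow_add, pow_mul, pow_mul]
  ring

lemma red_sum_abacus (m : ℕ) :
    red m ((∑ k ∈ piAntidiag (univ : Finset (Fin 5)) (15 * m),
      X ^ (abacusSum k - (15 * m).choose 2)) * euler) = red m (ex euler ^ 5) := by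
  obtain ⟨e, he⟩ := exists_euler_inv
  have hex : ex euler * ex e = 1 := by rw [← map_mul, he, map_one]
  have h := congrArg (red m) (qinv_eq_sum (3 * m))
  rw [red_qinv (by omega) he, map_sum, show 5 * (3 * m) = 15 * m by ring] at h
  have h2 : red m e = red m (∑ k ∈ piAntidiag (univ : Finset (Fin 5)) (15 * m),
      X ^ (abacusSum k - (15 * m).choose 2)) * red m (ex e) ^ 5 := by
    rw [h, map_sum, sum_mul]
    refine sum_congr rfl fun k hk => ?_
    have hk' : ∑ r, k r = 5 * (3 * m) := by
      rw [show 5 * (3 * m) = 15 * m by ring]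
      simpa using hk
    rw [map_mul]
    rcases lt_or_ge m (abacusSum k - (15 * m).choose 2) with hm | hm
    · rw [red_X_pow hm, zero_mul, zero_mul]
    · rw [map_prod]
      have (r : Fin 5) : red m (ex (qinv (k r))) = red m (ex e) := by
        refine red_ex (red_qinv ?_ he)
        have h3 := sq_le_of_abacusSum hk' r
        have h4 := two_mul_choose_two (15 * m)
        have h5 : (abacusSum k : ℤ) ≤ m + ((15 * m).choose 2 : ℕ) := by omega
        push_cast at h3 h4
        by_contra hlt
        have h6 : (k r : ℤ) + 1 ≤ m := by omega
        nlinarith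
      simp only [this, prod_const, card_univ, Fintype.card_fin]
  have h3 := congrArg (red m) he
  have h4 := congrArg (red m) (show ex e ^ 5 * ex euler ^ 5 = 1 by
    rw [← mul_pow, mul_comm, hex, one_pow])
  simp only [map_mul, map_one, map_pow] at h3 h4 ⊢
  set Q := red m (∑ k ∈ piAntidiag (univ : Finset (Fin 5)) (15 * m),
      X ^ (abacusSum k - (15 * m).choose 2))
  linear_combination (- Q * red m euler) * h4 - (red m euler * red m (ex euler) ^ 5) * h2 +
    red m (ex euler) ^ 5 * h3

/-! ### Partitions and beta sets -/

lemma antitone_getD {L : List ℕ} (h : L.Pairwise (· ≥ ·)) : Antitone (L.getD · 0) := by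
  intro i j hij
  rcases lt_or_ge j L.length with hj | hj
  · show L.getD j 0 ≤ L.getD i 0
    rw [List.getD_eq_getElem _ _ hj, List.getD_eq_getElem _ _ (hij.trans_lt hj)]
    rcases hij.eq_or_lt with rfl | hij
    · rfl
    · exact List.pairwise_iff_getElem.1 h i j _ hj hij
  · show L.getD j 0 ≤ _
    rw [List.getD_eq_default _ _ hj]
    exact Nat.zero_le _

lemma map_getD_range {L : List ℕ} {N : ℕ} (h : L.length ≤ N) :
    (List.range N).map (L.getD · 0) = L ++ List.replicate (N - L.length) 0 := by
  apply List.ext_getElem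
  · simp; omega
  · intro i h1 h2
    rcases lt_or_ge i L.length with hi | hi
    · simp [hi]
    · simp [List.getElem_append, not_lt.2 hi]

lemma eq_of_map_range_eq {N : ℕ} {f g : ℕ → ℕ} (hf : ∀ i j, i < j → j < N → f j ≤ f i)
    (hg : ∀ i j, i < j → j < N → g j ≤ g i)
    (h : (Multiset.range N).map f = (Multiset.range N).map g) {i : ℕ} (hi : i < N) :
    f i = g i := by
  have aux (f : ℕ → ℕ) (hf : ∀ i j, i < j → j < N → f j ≤ f i) :
      ((List.range N).map f).Pairwise (· ≥ ·) := by
    rw [List.pairwise_iff_getElem]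
    intro i j _ hj hij
    simp only [List.length_map, List.length_range] at hj
    simpa using hf i j hij hj
  rw [← Multiset.coe_range, Multiset.map_coe, Multiset.map_coe, Multiset.coe_eq_coe] at h
  have := h.eq_of_pairwise (fun a b _ _ h1 h2 => le_antisymm h2 h1) (aux f hf) (aux g hg)
  rw [List.map_inj_left] at this
  exact this i (List.mem_range.2 hi)

/-- The parts of a partition, in decreasing order and followed by zeros. -/
def part {n : ℕ} (p : n.Partition) (i : ℕ) : ℕ := (p.parts.sort (· ≤ ·)).reverse.getD i 0

lemma antitone_part {n : ℕ} (p : n.Partition) : Antitone (part p) :=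
  antitone_getD (List.pairwise_reverse.2 (p.parts.pairwise_sort (· ≤ ·)))

lemma card_parts_le {n : ℕ} (p : n.Partition) : p.parts.card ≤ n := by
  have := Multiset.card_nsmul_le_sum (s := p.parts) (a := 1) fun x hx => p.parts_pos hx
  rwa [p.parts_sum, smul_eq_mul, mul_one] at this

lemma part_eq_zero {n N : ℕ} (p : n.Partition) (hN : n ≤ N) : part p N = 0 := by
  rw [part, List.getD_eq_default]
  rw [List.length_reverse, Multiset.length_sort]
  exact (card_parts_le p).trans hN

lemma map_part_range {n N : ℕ} (p : n.Partition) (hN : n ≤ N) :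
    (Multiset.range N).map (part p) =
      p.parts + Multiset.replicate (N - p.parts.card) 0 := by
  have h : (p.parts.sort (· ≤ ·)).reverse.length = p.parts.card := by
    rw [List.length_reverse, Multiset.length_sort]
  have := map_getD_range (h.le.trans ((card_parts_le p).trans hN))
  rw [← Multiset.coe_range, Multiset.map_coe]
  show ((List.map (fun i => (p.parts.sort (· ≤ ·)).reverse.getD i 0) _ : List ℕ) : Multiset ℕ) = _
  rw [this, ← Multiset.coe_add, Multiset.coe_reverse, Multiset.sort_eq, h, Multiset.coe_replicate]

lemma parts_eq {n N : ℕ} (p : n.Partition) (hN : n ≤ N) :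
    p.parts = ((Multiset.range N).map (part p)).filter (0 < ·) := by
  rw [map_part_range p hN, Multiset.filter_add, Multiset.filter_eq_self.2 fun x => p.parts_pos,
    Multiset.filter_eq_nil.2, add_zero]
  intro a ha
  rw [Multiset.eq_of_mem_replicate ha]
  exact lt_irrefl 0

lemma sum_part {n N : ℕ} (p : n.Partition) (hN : n ≤ N) : ∑ i ∈ range N, part p i = n := by
  have := congrArg Multiset.sum (map_part_range p hN)
  rw [Multiset.sum_add, Multiset.sum_replicate, smul_zero, add_zero, p.parts_sum] at this
  exact this

lemma exists_partition {n N : ℕ} {f : ℕ → ℕ} (hf : ∀ i j, i < j → j < N → f j ≤ f i)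
    (hs : ∑ i ∈ range N, f i = n) (hN : n ≤ N) :
    ∃ p : n.Partition, ∀ i < N, part p i = f i := by
  set s := ((Multiset.range N).map f).filter (0 < ·) with hsdef
  have h0 : (Multiset.range N).map f = s + Multiset.replicate (N - s.card) 0 := by
    have h1 := Multiset.filter_add_not (0 < ·) ((Multiset.range N).map f)
    have h2 : ((Multiset.range N).map f).filter (fun x => ¬ 0 < x) =
        Multiset.replicate (N - s.card) 0 := by
      rw [Multiset.eq_replicate]
      constructor
      · have := congrArg Multiset.card h1
        rw [Multiset.card_add, Multiset.card_map, Multiset.card_range, ← hsdef] at this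
        omega
      · intro b hb
        have := (Multiset.mem_filter.1 hb).2
        omega
    rw [← h2, hsdef, h1]
  have hsum : s.sum = n := by
    have := congrArg Multiset.sum h0
    rw [Multiset.sum_add, Multiset.sum_replicate, smul_zero, add_zero] at this
    rw [← this, ← hs]
    rfl
  refine ⟨⟨s, fun hi => (Multiset.mem_filter.1 hi).2, hsum⟩, fun i hi => ?_⟩
  refine eq_of_map_range_eq (fun i j hij _ => antitone_part _ hij.le) hf ?_ hi
  rw [map_part_range _ hN]
  exact h0.symm

lemma partition_ext {n N : ℕ} {p q : n.Partition} (hN : n ≤ N)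
    (h : ∀ i < N, part p i = part q i) : p = q := by
  ext1
  rw [parts_eq p hN, parts_eq q hN, Multiset.map_congr rfl]
  intro i hi
  exact h i (Multiset.mem_range.1 hi)

lemma card_filter_parts {n r j : ℕ} (p : n.Partition) (h : ∀ i, j < part p i ↔ i < r) :
    (p.parts.filter fun x => j < x).card = r := by
  rw [parts_eq p (le_max_left n r), Multiset.filter_filter,
    Multiset.filter_congr (q := fun x => j < x) (fun x _ => by omega), Multiset.filter_map,
    Multiset.card_map, Multiset.filter_congr (p := (fun x => j < x) ∘ part p)
      (q := fun i => i < r) (fun x _ => h x)]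
  have : (range (max n r)).filter (· < r) = range r := by
    ext i
    simp only [mem_filter, mem_range]
    omega
  have := congrArg card this
  rwa [card_range] at this

lemma hookLength_eq {n i j r : ℕ} (p : n.Partition) (h : ∀ i, j < part p i ↔ i < r) :
    hookLength p i j = (part p i - j) + (r - i) - 1 := by
  rw [hookLength, card_filter_parts p h]
  rfl

/-- The beta set with `N` elements of a partition. -/
def betaSet (N : ℕ) {n : ℕ} (p : n.Partition) : Finset ℕ :=
  (range N).image fun i => part p i + (N - 1 - i)

lemma beta_lt {N n i j : ℕ} (p : n.Partition) (hij : i < j) (hj : j < N) :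
    part p j + (N - 1 - j) < part p i + (N - 1 - i) := by
  have := antitone_part p hij.le
  omega

lemma beta_injOn (N : ℕ) {n : ℕ} (p : n.Partition) :
    Set.InjOn (fun i => part p i + (N - 1 - i)) (range N : Set ℕ) := by
  intro i hi j hj hij
  simp only [coe_range, Set.mem_Iio] at hi hj
  rcases lt_trichotomy i j with h | h | h
  · have := beta_lt p h hj
    simp only at hij
    omega
  · exact h
  · have := beta_lt p h hi
    simp only at hij
    omega

lemma card_betaSet (N : ℕ) {n : ℕ} (p : n.Partition) : (betaSet N p).card = N := by
  rw [betaSet, card_image_of_injOn (beta_injOn N p), card_range]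

lemma sum_range_sub (N : ℕ) : ∑ i ∈ range N, (N - 1 - i) = N.choose 2 := by
  rw [sum_range_reflect (fun i => i), sum_range_id, Nat.choose_two_right]

lemma sum_betaSet {N n : ℕ} (p : n.Partition) (hN : n ≤ N) :
    ∑ x ∈ betaSet N p, x = n + N.choose 2 := by
  rw [betaSet, sum_image (beta_injOn N p), sum_add_distrib, sum_part p hN, sum_range_sub]

lemma betaSet_injective {N n : ℕ} {p q : n.Partition} (hN : n ≤ N)
    (h : betaSet N p = betaSet N q) : p = q := by
  refine partition_ext hN fun i hi => ?_
  have h1 := congrArg Finset.val h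
  rw [betaSet, betaSet, image_val_of_injOn (beta_injOn N p),
    image_val_of_injOn (beta_injOn N q)] at h1
  have := eq_of_map_range_eq (fun i j hij hj => (beta_lt p hij hj).le)
    (fun i j hij hj => (beta_lt q hij hj).le) h1 hi
  omega

lemma exists_betaSet_eq {N n : ℕ} {s : Finset ℕ} (hs : s.card = N)
    (hsum : ∑ x ∈ s, x = n + N.choose 2) (hN : n ≤ N) :
    ∃ p : n.Partition, betaSet N p = s := by
  obtain ⟨b, hb, hbs⟩ : ∃ b : ℕ → ℕ, (∀ i j, i < j → j < N → b j < b i) ∧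
      s = (range N).image b := by
    refine ⟨fun i => if h : i < N then s.orderEmbOfFin hs (Fin.rev ⟨i, h⟩) else 0, ?_, ?_⟩
    · intro i j hij hj
      simp only [hj, hij.trans hj, dif_pos]
      exact (s.orderEmbOfFin hs).strictMono (Fin.rev_lt_rev.2 hij)
    · ext x
      have hx : x ∈ s ↔ x ∈ Set.range (s.orderEmbOfFin hs) := by
        rw [range_orderEmbOfFin]; rfl
      rw [hx, mem_image]
      constructor
      · rintro ⟨i, rfl⟩
        refine ⟨Fin.rev i, mem_range.2 (Fin.rev i).2, ?_⟩
        rw [dif_pos (Fin.rev i).2]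
        rw [Fin.eta, Fin.rev_rev]
      · rintro ⟨i, hi, rfl⟩
        rw [dif_pos (mem_range.1 hi)]
        exact ⟨_, rfl⟩
  have hstep (d i : ℕ) (h : i + d < N) : b (i + d) + d ≤ b i := by
    induction d with
    | zero => rfl
    | succ d ih =>
      have h1 := ih (by omega)
      have h2 := hb (i + d) (i + (d + 1)) (by omega) h
      omega
  have hge (i : ℕ) (h : i < N) : N - 1 - i ≤ b i := by
    have := hstep (N - 1 - i) i (by omega)
    omega
  have hinj : Set.InjOn b (range N : Set ℕ) := by
    intro i hi j hj hij
    simp only [coe_range, Set.mem_Iio] at hi hj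
    rcases lt_trichotomy i j with h | h | h
    · have := hb i j h hj
      omega
    · exact h
    · have := hb j i h hi
      omega
  have hanti (i j : ℕ) (hij : i < j) (hj : j < N) : b j - (N - 1 - j) ≤ b i - (N - 1 - i) := by
    have := hstep (j - i) i (by omega)
    rw [Nat.add_sub_cancel' hij.le] at this
    omega
  have hn : ∑ i ∈ range N, (b i - (N - 1 - i)) = n := by
    have h1 : ∑ i ∈ range N, (b i - (N - 1 - i)) + ∑ i ∈ range N, (N - 1 - i) =
        ∑ i ∈ range N, b i := by
      rw [← sum_add_distrib]
      refine sum_congr rfl fun i hi => ?_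
      have := hge i (mem_range.1 hi)
      omega
    rw [sum_range_sub] at h1
    rw [hbs, sum_image hinj] at hsum
    omega
  obtain ⟨p, hp⟩ := exists_partition hanti hn hN
  refine ⟨p, ?_⟩
  rw [hbs, betaSet]
  refine image_congr fun i hi => ?_
  have hiN : i < N := by simpa using hi
  simp only [hp i hiN]
  have := hge i hiN
  omega

/-- A finite set of naturals is `t`-closed if it is stable under subtracting `t`. -/
def IsClosedUnderSub (t : ℕ) (s : Finset ℕ) : Prop := ∀ x, x + t ∈ s → x ∈ s

lemma IsClosedUnderSub.mul {t : ℕ} {s : Finset ℕ} (h : IsClosedUnderSub t s) {x : ℕ} (a : ℕ)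
    (hx : x + t * a ∈ s) : x ∈ s := by
  induction a with
  | zero => exact hx
  | succ a ih => exact ih (h _ (by rwa [add_assoc, ← Nat.mul_succ]))

lemma isTCore_iff {t N n : ℕ} (ht : 0 < t) (p : n.Partition) (hN : n ≤ N) :
    IsTCore t p ↔ IsClosedUnderSub t (betaSet N p) := by
  constructor
  · intro h y hy
    by_contra hy'
    obtain ⟨i, hi, hiy⟩ := mem_image.1 hy
    rw [mem_range] at hi
    have hne (k : ℕ) (hk : k < N) : part p k + (N - 1 - k) ≠ y := fun h =>
      hy' (mem_image.2 ⟨k, mem_range.2 hk, h⟩)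
    have hex : ∃ k, N ≤ k ∨ part p k + (N - 1 - k) < y := ⟨N, Or.inl le_rfl⟩
    classical
    obtain ⟨r, hr, hmin⟩ : ∃ r, (N ≤ r ∨ part p r + (N - 1 - r) < y) ∧
        ∀ k < r, ¬ (N ≤ k ∨ part p k + (N - 1 - k) < y) :=
      ⟨Nat.find hex, Nat.find_spec hex, fun k hk => Nat.find_min hex hk⟩
    have hrN : r ≤ N := by
      by_contra hlt
      exact hmin N (by omega) (Or.inl le_rfl)
    have hlt (k : ℕ) (hk : k < r) : y < part p k + (N - 1 - k) := by
      have h1 := hmin k hk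
      have h2 := hne k (by omega)
      omega
    have hir : i < r := by
      by_contra hri
      have h1 : r < N := by omega
      have h2 : part p i ≤ part p r := antitone_part p (by omega)
      omega
    have hj : ∀ k, y + r - N < part p k ↔ k < r := by
      intro k
      constructor
      · intro hk
        by_contra hkr
        have h1 : part p k ≤ part p r := antitone_part p (by omega)
        rcases hrN.eq_or_lt with rfl | hrN
        · rw [part_eq_zero p hN] at h1
          omega
        · omega
      · intro hk
        have h1 : part p (r - 1) ≤ part p k := antitone_part p (by omega)
        have h2 := hlt (r - 1) (by omega)
        omega
    refine h i (y + r - N) ((hj i).2 hir) ?_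
    rw [hookLength_eq p hj]
    have := (hj i).2 hir
    have : part p i - (y + r - N) + (r - i) - 1 = t := by omega
    rw [this]
  · rintro h i j hij ⟨a, ha⟩
    change j < part p i at hij
    have hex : ∃ k, part p k ≤ j := ⟨N, by rw [part_eq_zero p hN]; exact Nat.zero_le _⟩
    classical
    obtain ⟨r, hr, hmin⟩ : ∃ r, part p r ≤ j ∧ ∀ k < r, ¬ part p k ≤ j :=
      ⟨Nat.find hex, Nat.find_spec hex, fun k hk => Nat.find_min hex hk⟩
    have hj : ∀ k, j < part p k ↔ k < r := by
      intro k
      constructor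
      · intro hk
        by_contra hkr
        have h1 : part p k ≤ part p r := antitone_part p (by omega)
        omega
      · intro hk
        have := hmin k hk
        omega
    have hrN : r ≤ N := by
      by_contra hlt
      refine hmin N (by omega) ?_
      rw [part_eq_zero p hN]
      exact Nat.zero_le _
    have hir := (hj i).1 hij
    rw [hookLength_eq p hj] at ha
    have hmem : N - r + j ∈ betaSet N p := by
      refine h.mul a (mem_image.2 ⟨i, mem_range.2 (by omega), ?_⟩)
      omega
    obtain ⟨k, hk, hky⟩ := mem_image.1 hmem
    rw [mem_range] at hk
    have := hj k
    omega

/-- The abacus with `k r` beads on runner `r`. -/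
def abacus (k : Fin 5 → ℕ) : Finset ℕ :=
  (univ : Finset (Fin 5)).biUnion fun r => (range (k r)).image fun j => r + 5 * j

lemma mem_abacus {k : Fin 5 → ℕ} {r : Fin 5} {j : ℕ} : (r : ℕ) + 5 * j ∈ abacus k ↔ j < k r := by
  simp only [abacus, mem_biUnion, mem_univ, true_and, mem_image, mem_range]
  constructor
  · rintro ⟨s, i, hi, h⟩
    have hr := r.2
    have hs := s.2
    obtain rfl : s = r := Fin.ext (by omega)
    obtain rfl : i = j := by omega
    exact hi
  · intro h
    exact ⟨r, j, h, rfl⟩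

lemma exists_runner (x : ℕ) : ∃ (r : Fin 5) (j : ℕ), x = r + 5 * j :=
  ⟨⟨x % 5, Nat.mod_lt _ (by norm_num)⟩, x / 5, (Nat.mod_add_div x 5).symm⟩

lemma sum_abacus (k : Fin 5 → ℕ) (f : ℕ → ℕ) :
    ∑ x ∈ abacus k, f x = ∑ r : Fin 5, ∑ j ∈ range (k r), f (r + 5 * j) := by
  rw [abacus, sum_biUnion]
  · refine sum_congr rfl fun r _ => sum_image ?_
    intro i _ j _ h
    simp only at h
    omega
  · intro r _ s _ hrs
    rw [Function.onFun, disjoint_left]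
    intro x hx hy
    simp only [mem_image] at hx hy
    obtain ⟨i, _, rfl⟩ := hx
    obtain ⟨j, _, h⟩ := hy
    have hr := r.2
    have hs := s.2
    exact hrs (Fin.ext (by omega))

lemma card_abacus (k : Fin 5 → ℕ) : (abacus k).card = ∑ r, k r := by
  rw [card_eq_sum_ones, sum_abacus]
  simp

lemma sum_id_abacus (k : Fin 5 → ℕ) : ∑ x ∈ abacus k, x = abacusSum k := by
  rw [sum_abacus, abacusSum]
  refine sum_congr rfl fun r _ => ?_
  rw [sum_add_distrib, ← mul_sum, sum_range_id, Nat.choose_two_right, sum_const, card_range,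
    smul_eq_mul, mul_comm]

lemma abacus_injective : Function.Injective abacus := by
  intro k l h
  ext r
  refine eq_of_forall_lt_iff fun j => ?_
  rw [← mem_abacus, h, mem_abacus]

lemma isClosedUnderSub_abacus (k : Fin 5 → ℕ) : IsClosedUnderSub 5 (abacus k) := by
  intro x hx
  obtain ⟨r, j, rfl⟩ := exists_runner x
  rw [add_assoc, ← Nat.mul_succ, mem_abacus] at hx
  exact mem_abacus.2 (by omega)

lemma exists_abacus_eq {s : Finset ℕ} (hs : IsClosedUnderSub 5 s) : ∃ k, abacus k = s := by
  classical
  have hex (r : Fin 5) : ∃ j, (r : ℕ) + 5 * j ∉ s := by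
    by_contra! h
    have h1 := s.le_sup (f := id) (h (s.sup id + 1))
    simp only [id] at h1
    omega
  refine ⟨fun r => Nat.find (hex r), ?_⟩
  ext x
  obtain ⟨r, j, rfl⟩ := exists_runner x
  rw [mem_abacus]
  constructor
  · intro hj
    exact not_not.1 (Nat.find_min (hex r) hj)
  · intro hx
    by_contra hj
    refine Nat.find_spec (hex r) (hs.mul (j - Nat.find (hex r)) ?_)
    rwa [add_assoc, ← mul_add, Nat.add_sub_cancel' (not_lt.1 hj)]

lemma card_core_eq {n N : ℕ} (hN : n ≤ N) :
    Nat.card {p : n.Partition // IsTCore 5 p} =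
      #{k ∈ piAntidiag (univ : Finset (Fin 5)) N | abacusSum k = n + N.choose 2} := by
  have h (p : {p : n.Partition // IsTCore 5 p}) : ∃ k, abacus k = betaSet N p.1 :=
    exists_abacus_eq ((isTCore_iff (by norm_num) p.1 hN).1 p.2)
  choose φ hφ using h
  rw [← Fintype.card_coe, ← Nat.card_eq_fintype_card]
  refine Nat.card_eq_of_bijective (fun p => ⟨φ p, ?_⟩) ⟨?_, ?_⟩
  · rw [mem_filter]
    constructor
    · simp [← card_abacus, hφ, card_betaSet]
    · rw [← sum_id_abacus, hφ, sum_betaSet _ hN]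
  · intro p q hpq
    have h1 : φ p = φ q := congrArg Subtype.val hpq
    exact Subtype.ext (betaSet_injective hN (by rw [← hφ, ← hφ, h1]))
  · rintro ⟨k, hk⟩
    rw [mem_filter, mem_piAntidiag] at hk
    obtain ⟨p, hp⟩ := exists_betaSet_eq (n := n) (N := N) (s := abacus k)
      (by rw [card_abacus]; exact hk.1.1) (by rw [sum_id_abacus]; exact hk.2) hN
    have hcore : IsTCore 5 p := by
      rw [isTCore_iff (by norm_num) p hN, hp]
      exact isClosedUnderSub_abacus k
    refine ⟨⟨p, hcore⟩, Subtype.ext (abacus_injective ?_)⟩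
    simp only [hφ, hp]

lemma coreSeries_mul_euler : coreSeries 5 * euler = ex euler ^ 5 := by
  refine ext_red fun m => ?_
  rw [← red_sum_abacus m, map_mul, map_mul]
  congr 1
  refine red_eq_iff.2 fun j hj => ?_
  rw [coreSeries, coeff_mk, card_core_eq (show j ≤ 15 * m by omega), map_sum]
  simp only [coeff_X_pow]
  rw [sum_boole]
  congr 2
  refine filter_congr fun k hk => ?_
  have hk' : ∑ r, k r = 5 * (3 * m) := by
    rw [show 5 * (3 * m) = 15 * m by ring]
    simpa using hk
  have := choose_two_le_abacusSum hk'
  rw [show 5 * (3 * m) = 15 * m by ring] at this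
  omega

end FiveCore

theorem stmt_17 : ∀ i n : ℕ, 3125 ∣ numA 5 (15625 * i + 4) (25 * n + 21) := by
  intro i n
  have h := FiveCore.dvd_coeff_pow FiveCore.coreSeries_mul_euler i n
  rw [← FiveCore.numA_eq_coeff] at h
  exact_mod_cast h
end

section
/- For all integers i ≥ 0 and n ≥ 0, A_{5, 390625 i + 4}(125 n + 121) ≡ 0 (mod 15625). -/
section

open PowerSeries Finset

/-- The truncated Euler product `(q; q)_k` as a power series. -/
noncomputable def qPoch (k : ℕ) : ℤ⟦X⟧ := ∏ i ∈ range k, (1 - X ^ (i + 1))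

/-- The generating function of the sums of the `k`-element subsets of `{0, …, M - 1}`. -/
noncomputable def subsetSeries (M k : ℕ) : ℤ⟦X⟧ :=
  ∑ B ∈ powersetCard k (range M), X ^ (∑ b ∈ B, b)

theorem qPoch_succ (k : ℕ) : qPoch (k + 1) = qPoch k * (1 - X ^ (k + 1)) := prod_range_succ ..

@[simp] theorem qPoch_zero : qPoch 0 = 1 := by simp [qPoch]

@[simp] theorem constantCoeff_qPoch (k : ℕ) : constantCoeff (qPoch k) = 1 := by
  simp [qPoch, map_prod]

theorem isUnit_qPoch (k : ℕ) : IsUnit (qPoch k) := by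
  simp [PowerSeries.isUnit_iff_constantCoeff]

theorem X_pow_dvd_qPoch_sub (k l : ℕ) : (X : ℤ⟦X⟧) ^ (k + 1) ∣ qPoch (k + l) - qPoch k := by
  induction l with
  | zero => simp
  | succ l ih =>
    rw [← add_assoc, qPoch_succ]
    have : qPoch (k + l) * (1 - X ^ (k + l + 1)) - qPoch k
        = (qPoch (k + l) - qPoch k) - X ^ (k + 1) * (X ^ l * qPoch (k + l)) := by ring
    rw [this]
    exact dvd_sub ih (dvd_mul_right _ _)

theorem X_pow_dvd_pentagonalSeries_sub (k : ℕ) :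
    (X : ℤ⟦X⟧) ^ (k + 1) ∣ pentagonalSeries ℤ - qPoch k := by
  rw [X_pow_dvd_iff]
  intro m hm
  obtain ⟨s, hs⟩ := Filter.eventually_atTop.1 (coeff_prod_one_sub_X_pow_eventually_eq ℤ m)
  obtain ⟨N, hN⟩ := s.exists_nat_subset_range
  have h1 := hs (range (k + N)) (hN.trans (range_subset_range.2 (by omega)))
  have h2 := X_pow_dvd_iff.1 (X_pow_dvd_qPoch_sub k N) m hm
  rw [map_sub] at h2 ⊢
  rw [← h1]
  exact h2

theorem subsetSeries_zero_right (M : ℕ) : subsetSeries M 0 = 1 := by simp [subsetSeries]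

theorem subsetSeries_succ_succ (M k : ℕ) :
    subsetSeries (M + 1) (k + 1) = subsetSeries M (k + 1) + X ^ M * subsetSeries M k := by
  unfold subsetSeries
  rw [range_add_one, powersetCard_succ_insert (by simp), sum_union, sum_image, mul_sum]
  · congr 1
    refine sum_congr rfl fun B hB ↦ ?_
    have : M ∉ B := fun h ↦ by simpa using (mem_powersetCard.1 hB).1 h
    rw [sum_insert this, pow_add]
  · intro B hB C hC h
    have h1 : M ∉ B := fun h ↦ by simpa using (mem_powersetCard.1 hB).1 h
    have h2 : M ∉ C := fun h ↦ by simpa using (mem_powersetCard.1 hC).1 h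
    rw [← erase_insert h1, ← erase_insert h2, h]
  · rw [disjoint_left]
    intro B hB hC
    obtain ⟨C, -, rfl⟩ := mem_image.1 hC
    simpa using (mem_powersetCard.1 hB).1 (mem_insert_self M C)

theorem subsetSeries_eq_zero {M k : ℕ} (h : M < k) : subsetSeries M k = 0 := by
  rw [subsetSeries, powersetCard_eq_empty.2 (by simpa using h), sum_empty]

theorem subsetSeries_mul_qPoch (k l : ℕ) :
    subsetSeries (k + l) k * qPoch k * qPoch l = X ^ (k.choose 2) * qPoch (k + l) := by
  obtain ⟨M, hM⟩ : ∃ M, M = k + l := ⟨_, rfl⟩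
  induction M generalizing k l with
  | zero =>
    obtain ⟨rfl, rfl⟩ : k = 0 ∧ l = 0 := by omega
    simp [subsetSeries_zero_right]
  | succ M ih =>
    rcases k with _ | k
    · simp [subsetSeries_zero_right]
    have e1 : k + 1 + l = (k + l) + 1 := by omega
    rw [e1, subsetSeries_succ_succ]
    have h1 := ih k l (by omega)
    have hc : (k + 1).choose 2 = k + k.choose 2 := by
      rw [Nat.choose_succ_succ' k 1]; simp
    rcases l with _ | l
    · rw [subsetSeries_eq_zero (by omega)]
      simp only [add_zero, qPoch_zero, mul_one, zero_add] at h1 ⊢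
      rw [qPoch_succ, hc, pow_add]
      linear_combination (X ^ k * (1 - X ^ (k + 1))) * h1
    · have h2 := ih (k + 1) l (by omega)
      rw [show k + 1 + l = k + (l + 1) by omega, hc] at h2
      rw [qPoch_succ (k + (l + 1)), hc]
      rw [qPoch_succ l] at h1 ⊢
      rw [qPoch_succ k] at h2 ⊢
      linear_combination (1 - X ^ (l + 1)) * h2 + X ^ (k + (l + 1)) * (1 - X ^ (k + 1)) * h1

theorem X_pow_dvd_subsetSeries_mul_qPoch_sub (k l : ℕ) :
    (X : ℤ⟦X⟧) ^ (l + 1) ∣ subsetSeries (k + l) k * qPoch k - X ^ (k.choose 2) := by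
  rw [← (isUnit_qPoch l).dvd_mul_right, sub_mul, subsetSeries_mul_qPoch, ← mul_sub, add_comm k l]
  exact (X_pow_dvd_qPoch_sub l k).mul_left _

/-- The Gaussian binomial coefficient `[k + l, k]` as a power series. -/
noncomputable def gaussSeries (k l : ℕ) : ℤ⟦X⟧ :=
  qPoch (k + l) * Ring.inverse (qPoch k) * Ring.inverse (qPoch l)

theorem gaussSeries_comm (k l : ℕ) : gaussSeries k l = gaussSeries l k := by
  rw [gaussSeries, gaussSeries, add_comm]; ring

theorem gaussSeries_mul (k l : ℕ) : gaussSeries k l * qPoch k * qPoch l = qPoch (k + l) := by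
  have h1 := Ring.inverse_mul_cancel _ (isUnit_qPoch k)
  have h2 := Ring.inverse_mul_cancel _ (isUnit_qPoch l)
  rw [gaussSeries]
  linear_combination (qPoch (k + l) * Ring.inverse (qPoch l) * qPoch l) * h1 + qPoch (k + l) * h2

theorem subsetSeries_eq (k l : ℕ) :
    subsetSeries (k + l) k = X ^ (k.choose 2) * gaussSeries k l := by
  have h := subsetSeries_mul_qPoch k l
  rw [← gaussSeries_mul] at h
  refine ((isUnit_qPoch k).mul (isUnit_qPoch l)).mul_right_cancel ?_
  linear_combination h

theorem isUnit_pentagonalSeries : IsUnit (pentagonalSeries ℤ) := by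
  rw [PowerSeries.isUnit_iff_constantCoeff]
  have h := X_dvd_iff.1 (by simpa using X_pow_dvd_pentagonalSeries_sub 0)
  rw [map_sub, sub_eq_zero] at h
  simp [h]

theorem X_pow_dvd_pentagonalSeries_mul_gaussSeries_sub {s k l : ℕ} (hk : s ≤ k) (hl : s ≤ l) :
    (X : ℤ⟦X⟧) ^ (s + 1) ∣ pentagonalSeries ℤ * gaussSeries k l - 1 := by
  have key (k : ℕ) (hk : s ≤ k) : (X : ℤ⟦X⟧) ^ (s + 1) ∣ pentagonalSeries ℤ - qPoch k :=
    (pow_dvd_pow _ (by omega)).trans (X_pow_dvd_pentagonalSeries_sub k)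
  have h := gaussSeries_mul k l
  rw [← isUnit_pentagonalSeries.dvd_mul_right]
  have e : (pentagonalSeries ℤ * gaussSeries k l - 1) * pentagonalSeries ℤ =
      (pentagonalSeries ℤ - qPoch k) * (gaussSeries k l * pentagonalSeries ℤ)
      + (pentagonalSeries ℤ - qPoch l) * (gaussSeries k l * qPoch k)
      - (pentagonalSeries ℤ - qPoch (k + l)) := by
    linear_combination h
  rw [e]
  exact dvd_sub (dvd_add ((key k hk).mul_right _) ((key l hl).mul_right _)) (key _ (by omega))

theorem prod_X_pow_sub_X_pow (n : ℕ) :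
    ∏ j ∈ (range (2 * n + 1)).erase n, ((X : ℤ⟦X⟧) ^ n - X ^ j) =
      (-1) ^ n * X ^ (n * n + n.choose 2) * qPoch n ^ 2 := by
  have e : (range (2 * n + 1)).erase n = range n ∪ (range n).image (n + 1 + ·) := by
    ext j
    simp only [mem_erase, mem_range, mem_union, mem_image]
    constructor
    · rintro ⟨h1, h2⟩
      by_cases h : j < n
      · exact Or.inl h
      · exact Or.inr ⟨j - (n + 1), by omega, by omega⟩
    · rintro (h | ⟨i, h, rfl⟩) <;> omega
  rw [e, prod_union, prod_image]
  · have h1 : ∏ j ∈ range n, ((X : ℤ⟦X⟧) ^ n - X ^ j)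
        = (-1) ^ n * X ^ (n.choose 2) * qPoch n := by
      have : ∀ j ∈ range n, ((X : ℤ⟦X⟧) ^ n - X ^ j)
          = (-1) * X ^ j * (1 - X ^ (n - 1 - j + 1)) := by
        intro j hj
        have hj := mem_range.1 hj
        have : (X : ℤ⟦X⟧) ^ n = X ^ j * X ^ (n - 1 - j + 1) := by
          rw [← pow_add]; congr 1; omega
        rw [this]; ring
      rw [prod_congr rfl this, prod_mul_distrib, prod_mul_distrib,
        prod_range_reflect (fun i ↦ (1 : ℤ⟦X⟧) - X ^ (i + 1)), prod_pow_eq_pow_sum,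
        sum_range_id, ← Nat.choose_two_right]
      simp [qPoch]
    have h2 : ∏ j ∈ range n, ((X : ℤ⟦X⟧) ^ n - X ^ (n + 1 + j)) = X ^ (n * n) * qPoch n := by
      have : ∀ j ∈ range n, ((X : ℤ⟦X⟧) ^ n - X ^ (n + 1 + j)) = X ^ n * (1 - X ^ (j + 1)) := by
        intro j _
        ring
      rw [prod_congr rfl this, prod_mul_distrib]
      simp [qPoch, pow_mul]
    rw [h1, h2]
    ring
  · intro a _ b _ h
    simpa using h
  · rw [disjoint_left]
    intro a ha h
    obtain ⟨i, -, rfl⟩ := mem_image.1 h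
    simp at ha
    omega

theorem two_mul_choose_two (n : ℕ) : 2 * n.choose 2 + n = n * n := by
  induction n with
  | zero => simp
  | succ n ih => rw [Nat.choose_succ_succ' n 1, Nat.choose_one_right]; linarith

theorem qPoch_sq (n : ℕ) :
    qPoch n ^ 2 = ∑ i ∈ range (n + 1),
      (-1) ^ i * ((2 * i + 1 : ℕ) : ℤ⟦X⟧) * X ^ ((i + 1).choose 2) *
        gaussSeries (n - i) (n + 1 + i) := by
  have hF := Multiset.prod_X_sub_X_eq_sum_esymm
    ((range (2 * n + 1)).val.map fun j ↦ (X : ℤ⟦X⟧) ^ j)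
  have hes (k : ℕ) : ((range (2 * n + 1)).val.map fun j ↦ (X : ℤ⟦X⟧) ^ j).esymm k =
      subsetSeries (2 * n + 1) k := by
    rw [Finset.esymm_map_val, subsetSeries]
    exact sum_congr rfl fun B _ ↦ prod_pow_eq_pow_sum ..
  simp only [hes] at hF
  have hprod : (((range (2 * n + 1)).val.map fun j ↦ (X : ℤ⟦X⟧) ^ j).map
      fun t ↦ Polynomial.X - Polynomial.C t).prod =
      (Polynomial.X - Polynomial.C ((X : ℤ⟦X⟧) ^ n)) *
        ∏ j ∈ (range (2 * n + 1)).erase n, (Polynomial.X - Polynomial.C ((X : ℤ⟦X⟧) ^ j)) := by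
    rw [mul_prod_erase _ (fun j ↦ Polynomial.X - Polynomial.C ((X : ℤ⟦X⟧) ^ j))
      (mem_range.2 (by omega))]
    simp [Multiset.map_map, Finset.prod]
  rw [hprod] at hF
  have hD := congrArg (fun p ↦ (Polynomial.derivative p).eval ((X : ℤ⟦X⟧) ^ n)) hF
  have hterm (k m : ℕ) (c : ℤ⟦X⟧) : (Polynomial.derivative
      ((-1) ^ k * (Polynomial.C c * Polynomial.X ^ m))).eval ((X : ℤ⟦X⟧) ^ n) =
      (-1) ^ k * c * (m : ℤ⟦X⟧) * X ^ (n * (m - 1)) := by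
    have : ((-1) ^ k * (Polynomial.C c * Polynomial.X ^ m) : Polynomial ℤ⟦X⟧) =
        Polynomial.C ((-1) ^ k * c) * Polynomial.X ^ m := by
      simp [mul_assoc]
    rw [this, Polynomial.derivative_C_mul_X_pow]
    simp [pow_mul]
  simp only [Polynomial.derivative_sum, Polynomial.eval_finsetSum, hterm] at hD
  simp only [Polynomial.derivative_mul, Polynomial.eval_add, Polynomial.eval_mul,
    Polynomial.derivative_sub, Polynomial.derivative_X, Polynomial.derivative_C,
    Polynomial.eval_sub, Polynomial.eval_X, Polynomial.eval_C, sub_self, zero_mul, add_zero,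
    Polynomial.eval_prod, sub_zero, one_mul] at hD
  rw [prod_X_pow_sub_X_pow] at hD
  simp only [Multiset.card_map, card_val, card_range] at hD
  rw [show 2 * n + 1 + 1 = (n + 1) + (n + 1) by omega, sum_range_add,
    ← sum_range_reflect, ← sum_add_distrib] at hD
  have hX : ((-1) ^ n * X ^ (n * n + n.choose 2) : ℤ⟦X⟧) ≠ 0 := by
    have : (X : ℤ⟦X⟧) ≠ 0 := X_ne_zero
    simp [this]
  apply mul_left_cancel₀ hX
  rw [hD, mul_sum]
  refine sum_congr rfl fun i hi ↦ ?_
  obtain ⟨j, rfl⟩ : ∃ j, n = i + j := ⟨n - i, by have := mem_range.1 hi; omega⟩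
  rw [show i + j + 1 - 1 - i = j by omega, show i + j - i = j by omega,
    show 2 * (i + j) + 1 - j = i + j + 1 + i by omega,
    show 2 * (i + j) + 1 - (i + j + 1 + i) = j by omega,
    show 2 * (i + j) + 1 = j + (i + j + 1 + i) by omega, subsetSeries_eq]
  rw [show j + (i + j + 1 + i) = (i + j + 1 + i) + j by omega, subsetSeries_eq,
    gaussSeries_comm _ j]
  have a1 := two_mul_choose_two j
  have a2 := two_mul_choose_two (i + j)
  have a3 := two_mul_choose_two (i + 1)
  have a4 := two_mul_choose_two (i + j + 1 + i)
  have s1 : ((-1) ^ (i + j) * (-1) ^ i : ℤ⟦X⟧) = (-1) ^ j := by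
    rw [← pow_add, show i + j + i = j + 2 * i by omega, pow_add, pow_mul]; simp
  have s2 : ((-1) ^ (i + j + 1 + i) : ℤ⟦X⟧) = - (-1) ^ j := by
    rw [show i + j + 1 + i = j + 2 * i + 1 by omega, pow_succ, pow_add, pow_mul]; simp
  have p1 : (X : ℤ⟦X⟧) ^ (j.choose 2) * X ^ ((i + j) * (i + j + 1 + i - 1)) =
      X ^ ((i + j) * (i + j) + (i + j).choose 2) * X ^ ((i + 1).choose 2) := by
    rw [← pow_add, ← pow_add]
    congr 1
    rw [show i + j + 1 + i - 1 = i + j + i by omega]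
    nlinarith
  have p2 : (j : ℤ⟦X⟧) * ((X : ℤ⟦X⟧) ^ ((i + j + 1 + i).choose 2) * X ^ ((i + j) * (j - 1))) =
      (j : ℤ⟦X⟧) * ((X : ℤ⟦X⟧) ^ ((i + j) * (i + j) + (i + j).choose 2) * X ^ ((i + 1).choose 2)) := by
    rcases j with _ | j
    · simp
    rw [← pow_add, ← pow_add]
    congr 2
    rw [show j + 1 - 1 = j by omega]
    nlinarith
  rw [s2]
  push_cast
  linear_combination ((-1) ^ j * gaussSeries j (i + j + 1 + i) * (i + j + 1 + i)) * p1
    - ((-1) ^ j * gaussSeries j (i + j + 1 + i)) * p2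
    - (X ^ ((i + j) * (i + j) + (i + j).choose 2) * ((2 * i + 1)
      * X ^ ((i + 1).choose 2) * gaussSeries j (i + j + 1 + i))) * s1

/-- **Jacobi's identity** for the cube of the Euler function, modulo `X ^ (n + 1)`. -/
theorem X_pow_dvd_pentagonalSeries_cube_sub (n : ℕ) :
    (X : ℤ⟦X⟧) ^ (n + 1) ∣ pentagonalSeries ℤ ^ 3 - ∑ i ∈ range (n + 1),
      (-1) ^ i * ((2 * i + 1 : ℕ) : ℤ⟦X⟧) * X ^ ((i + 1).choose 2) := by
  have h1 := X_pow_dvd_pentagonalSeries_sub n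
  have e : pentagonalSeries ℤ ^ 3 - ∑ i ∈ range (n + 1),
      (-1) ^ i * ((2 * i + 1 : ℕ) : ℤ⟦X⟧) * X ^ ((i + 1).choose 2) =
      (pentagonalSeries ℤ - qPoch n) * (pentagonalSeries ℤ * (pentagonalSeries ℤ + qPoch n)) +
      ∑ i ∈ range (n + 1), (-1) ^ i * ((2 * i + 1 : ℕ) : ℤ⟦X⟧) * (X ^ ((i + 1).choose 2) *
        (pentagonalSeries ℤ * gaussSeries (n - i) (n + 1 + i) - 1)) := by
    have := congrArg (pentagonalSeries ℤ * ·) (qPoch_sq n)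
    simp only [mul_sum] at this
    rw [show (pentagonalSeries ℤ - qPoch n) * (pentagonalSeries ℤ * (pentagonalSeries ℤ + qPoch n))
      = pentagonalSeries ℤ ^ 3 - pentagonalSeries ℤ * qPoch n ^ 2 by ring, this, sub_add,
      ← sum_sub_distrib]
    congr 1
    refine sum_congr rfl fun i _ ↦ ?_
    ring
  rw [e]
  refine dvd_add (h1.mul_right _) (dvd_sum fun i hi ↦ Dvd.dvd.mul_left ?_ _)
  have hi := mem_range.1 hi
  have := X_pow_dvd_pentagonalSeries_mul_gaussSeries_sub
    (s := n - i) (k := n - i) (l := n + 1 + i) le_rfl (by omega)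
  refine (pow_dvd_pow _ ?_).trans ((pow_add _ _ _).dvd.trans (mul_dvd_mul_left (X ^ _) this))
  rw [Nat.choose_succ_succ' i 1, Nat.choose_one_right]
  omega

theorem coeff_pentagonalSeries_cube_eq_zero {m : ℕ} (hm : m % 5 = 2) :
    coeff m (pentagonalSeries ℤ ^ 3) = 0 := by
  have h := X_pow_dvd_iff.1 (X_pow_dvd_pentagonalSeries_cube_sub m) m (by omega)
  rw [map_sub, sub_eq_zero] at h
  rw [h, map_sum]
  refine sum_eq_zero fun i _ ↦ ?_
  have : ((-1) ^ i * ((2 * i + 1 : ℕ) : ℤ⟦X⟧)) = C ((-1) ^ i * ((2 * i + 1 : ℕ) : ℤ)) := by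
    simp
  rw [this, coeff_C_mul, coeff_X_pow, if_neg, mul_zero]
  rintro rfl
  have h2 := two_mul_choose_two (i + 1)
  have h3 : (2 * (i + 1).choose 2 + (i + 1)) % 5 = ((i + 1) * (i + 1)) % 5 := by rw [h2]
  rw [Nat.mul_mod] at h3
  have : i % 5 < 5 := Nat.mod_lt _ (by norm_num)
  interval_cases hi : i % 5 <;> simp [Nat.add_mod, Nat.mul_mod, hi, hm] at h3

/-- The part of a power series supported on the exponents congruent to `r` modulo `5`. -/
noncomputable def residuePart (r : ℕ) : ℤ⟦X⟧ →+ ℤ⟦X⟧ :=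
  AddMonoidHom.mk' (fun f ↦ PowerSeries.mk fun n ↦ if n % 5 = r % 5 then coeff n f else 0) <| by
    intro f g
    ext n
    simp only [coeff_mk, map_add]
    split_ifs <;> simp

theorem coeff_residuePart (r n : ℕ) (f : ℤ⟦X⟧) :
    coeff n (residuePart r f) = if n % 5 = r % 5 then coeff n f else 0 := by
  simp [residuePart]

theorem residuePart_add_five (r : ℕ) : residuePart (r + 5) = residuePart r := by
  ext f n
  simp [coeff_residuePart]

/-- A power series is supported on the exponents congruent to `s` modulo `5`. -/
def SupportedOn (s : ℕ) (g : ℤ⟦X⟧) : Prop := ∀ n, n % 5 ≠ s % 5 → coeff n g = 0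

theorem residuePart_mul {s : ℕ} {g : ℤ⟦X⟧} (hg : SupportedOn s g) (r : ℕ) (f : ℤ⟦X⟧) :
    residuePart (r + s) (g * f) = g * residuePart r f := by
  ext n
  rw [coeff_residuePart, coeff_mul, coeff_mul, ← sum_filter_add_sum_filter_not _ (fun p ↦ p.1 % 5 = s % 5)]
  rw [ite_eq_iff']
  constructor <;> intro h
  · rw [← sum_filter_add_sum_filter_not (antidiagonal n) (fun p ↦ p.1 % 5 = s % 5)]
    congr 1
    · refine sum_congr rfl fun p hp ↦ ?_
      rw [mem_filter, HasAntidiagonal.mem_antidiagonal] at hp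
      rw [coeff_residuePart, if_pos (by omega)]
    · refine sum_congr rfl fun p hp ↦ ?_
      rw [mem_filter] at hp
      rw [hg _ hp.2, zero_mul, zero_mul]
  · symm
    refine sum_eq_zero fun p hp ↦ ?_
    have hp := HasAntidiagonal.mem_antidiagonal.1 hp
    by_cases h' : p.1 % 5 = s % 5
    · rw [coeff_residuePart, if_neg (by omega), mul_zero]
    · rw [hg _ h', zero_mul]

theorem supportedOn_residuePart (r : ℕ) (f : ℤ⟦X⟧) : SupportedOn r (residuePart r f) := by
  intro n hn
  rw [coeff_residuePart, if_neg hn]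

theorem SupportedOn.mul {r s : ℕ} {f g : ℤ⟦X⟧} (hf : SupportedOn r f) (hg : SupportedOn s g) :
    SupportedOn (r + s) (f * g) := by
  intro n hn
  rw [coeff_mul]
  refine sum_eq_zero fun p hp ↦ ?_
  have hp := HasAntidiagonal.mem_antidiagonal.1 hp
  by_cases h : p.1 % 5 = r % 5
  · rw [hg _ (by omega), mul_zero]
  · rw [hf _ h, zero_mul]

theorem SupportedOn.neg {r : ℕ} {f : ℤ⟦X⟧} (hf : SupportedOn r f) : SupportedOn r (-f) := by
  intro n hn
  rw [map_neg, hf n hn, neg_zero]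

theorem SupportedOn.add {r : ℕ} {f g : ℤ⟦X⟧} (hf : SupportedOn r f) (hg : SupportedOn r g) :
    SupportedOn r (f + g) := by
  intro n hn
  rw [map_add, hf n hn, hg n hn, add_zero]

theorem SupportedOn.pow {r : ℕ} {f : ℤ⟦X⟧} (hf : SupportedOn r f) (k : ℕ) :
    SupportedOn (r * k) (f ^ k) := by
  induction k with
  | zero =>
    intro n hn
    rw [pow_zero, coeff_one, if_neg]
    rintro rfl
    simp at hn
  | succ k ih =>
    rw [pow_succ, mul_add, mul_one]
    exact ih.mul hf

theorem SupportedOn.congr {r s : ℕ} {f : ℤ⟦X⟧} (hf : SupportedOn r f) (h : r % 5 = s % 5) :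
    SupportedOn s f := fun n hn ↦ hf n (h ▸ hn)

theorem supportedOn_expand (f : ℤ⟦X⟧) : SupportedOn 0 (expand 5 (by norm_num) f) := by
  intro n hn
  rw [coeff_expand_of_not_dvd]
  omega

theorem residuePart_one : residuePart 0 1 = 1 := by
  ext n
  rw [coeff_residuePart, coeff_one]
  split_ifs <;> simp_all

/-- The Euler function `(q; q)_∞`. -/
noncomputable abbrev eulerSeries : ℤ⟦X⟧ := pentagonalSeries ℤ

/-- The Euler function in `q ^ 5`. -/
noncomputable abbrev eulerSeries5 : ℤ⟦X⟧ := expand 5 (by norm_num) eulerSeries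

/-- The Euler function in `q ^ 25`. -/
noncomputable abbrev eulerSeries25 : ℤ⟦X⟧ := expand 5 (by norm_num) eulerSeries5

theorem pentagonal_emod (k : ℤ) :
    (pentagonal k % 5 = 1 ↔ k % 5 = 1) ∧ pentagonal k % 5 < 3 := by
  have h := two_mul_natCast_pentagonal k
  obtain ⟨r, j, rfl, h0, h5⟩ : ∃ r j, k = r + 5 * j ∧ 0 ≤ r ∧ r < 5 :=
    ⟨k % 5, k / 5, by omega, by omega, by omega⟩
  obtain ⟨w, hw⟩ : ∃ w, (r + 5 * j) * (3 * (r + 5 * j) - 1) = r * (3 * r - 1) + 5 * w :=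
    ⟨6 * r * j + 15 * j * j - j, by ring⟩
  rw [hw] at h
  interval_cases r <;> omega

theorem pentagonal_five_mul_add_one (j : ℤ) : pentagonal (5 * j + 1) = 1 + 25 * pentagonal (-j) := by
  have h1 := two_mul_natCast_pentagonal (5 * j + 1)
  have h2 := two_mul_natCast_pentagonal_neg j
  zify
  linarith

theorem residuePart_one_eulerSeries : residuePart 1 eulerSeries = -(X * eulerSeries25) := by
  ext n
  rw [coeff_residuePart, map_neg]
  rcases n with _ | n
  · simp
  rw [mul_comm, coeff_succ_mul_X, coeff_expand, coeff_expand]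
  by_cases h : ∃ k, pentagonal k = n + 1
  · obtain ⟨k, hk⟩ := h
    have hm := (pentagonal_emod k).1
    by_cases h1 : k % 5 = 1
    · obtain ⟨j, rfl⟩ : ∃ j, k = 5 * j + 1 := ⟨k / 5, by omega⟩
      have h2 := pentagonal_five_mul_add_one j
      rw [if_pos (by omega), if_pos (by omega), if_pos (by omega), ← hk,
        show n / 5 / 5 = pentagonal (-j) by omega]
      rw [coeff_pentagonalSeries_pentagonal, coeff_pentagonalSeries_pentagonal,
        show 5 * j + 1 = -j + (6 * j + 1) by ring, Int.negOnePow_add,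
        Int.negOnePow_odd (6 * j + 1) ⟨3 * j, by ring⟩]
      simp
    · rw [if_neg (by omega)]
      split_ifs with h2 h3
      · omega
      · simp
      · simp
  · rw [coeff_pentagonalSeries_eq_zero _ (by simpa using h)]
    split_ifs with h2 h3 h4
    · rw [coeff_pentagonalSeries_eq_zero _ ?_, neg_zero]
      rintro ⟨j, hj⟩
      refine h ⟨5 * (-j) + 1, ?_⟩
      rw [pentagonal_five_mul_add_one, neg_neg]
      omega
    all_goals omega

theorem eulerSeries_eq :
    eulerSeries = residuePart 0 eulerSeries + residuePart 1 eulerSeries +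
      residuePart 2 eulerSeries := by
  ext n
  rw [map_add, map_add, coeff_residuePart, coeff_residuePart, coeff_residuePart]
  by_cases h : ∃ k, pentagonal k = n
  · obtain ⟨k, rfl⟩ := h
    have := (pentagonal_emod k).2
    rcases (by omega : pentagonal k % 5 = 0 ∨ pentagonal k % 5 = 1 ∨ pentagonal k % 5 = 2) with
      h | h | h <;> simp [h]
  · rw [coeff_pentagonalSeries_eq_zero _ (by simpa using h)]
    simp

theorem residuePart_eulerSeries_mul (r : ℕ) (f : ℤ⟦X⟧) :
    residuePart (r + 2) (eulerSeries * f) =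
      residuePart 0 eulerSeries * residuePart (r + 2) f +
      residuePart 1 eulerSeries * residuePart (r + 1) f +
      residuePart 2 eulerSeries * residuePart r f := by
  conv_lhs => rw [eulerSeries_eq, add_mul, add_mul, map_add, map_add]
  rw [residuePart_mul (supportedOn_residuePart 2 _), ← residuePart_mul (supportedOn_residuePart 1 _),
    ← residuePart_mul (supportedOn_residuePart 0 _)]

theorem residuePart_three_eulerSeries : residuePart 3 eulerSeries = 0 := by
  ext n
  rw [coeff_residuePart]
  by_cases h : ∃ k, pentagonal k = n
  · obtain ⟨k, rfl⟩ := h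
    have := (pentagonal_emod k).2
    rw [if_neg (by omega), map_zero]
  · rw [coeff_pentagonalSeries_eq_zero _ (by simpa using h)]
    simp

theorem residuePart_four_eulerSeries : residuePart 4 eulerSeries = 0 := by
  ext n
  rw [coeff_residuePart]
  by_cases h : ∃ k, pentagonal k = n
  · obtain ⟨k, rfl⟩ := h
    have := (pentagonal_emod k).2
    rw [if_neg (by omega), map_zero]
  · rw [coeff_pentagonalSeries_eq_zero _ (by simpa using h)]
    simp

theorem residuePart_eulerSeries_sq :
    residuePart 0 (eulerSeries ^ 2) = residuePart 0 eulerSeries ^ 2 ∧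
    residuePart 1 (eulerSeries ^ 2) = 2 * residuePart 0 eulerSeries * residuePart 1 eulerSeries ∧
    residuePart 2 (eulerSeries ^ 2) = residuePart 1 eulerSeries ^ 2 +
      2 * residuePart 0 eulerSeries * residuePart 2 eulerSeries ∧
    residuePart 3 (eulerSeries ^ 2) = 2 * residuePart 1 eulerSeries * residuePart 2 eulerSeries ∧
    residuePart 4 (eulerSeries ^ 2) = residuePart 2 eulerSeries ^ 2 := by
  have h (r) := residuePart_eulerSeries_mul r eulerSeries
  rw [← sq] at h
  have h0 := h 3
  have h1 := h 4
  have h2 := h 0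
  have h3 := h 1
  have h4 := h 2
  have e5 := residuePart_add_five 0
  have e6 := residuePart_add_five 1
  norm_num [residuePart_three_eulerSeries, residuePart_four_eulerSeries] at h0 h1 h2 h3 h4 e5 e6
  rw [e5] at h0 h1
  rw [e6] at h1
  rw [h0, h1, h2, h3, h4]
  refine ⟨?_, ?_, ?_, ?_, ?_⟩ <;> ring

theorem residuePart_zero_eulerSeries_ne_zero : residuePart 0 eulerSeries ≠ 0 := by
  intro h
  have h := congrArg (coeff 0) h
  rw [coeff_residuePart, if_pos rfl] at h
  have := coeff_pentagonalSeries_pentagonal ℤ 0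
  simp [pentagonal_def] at this
  simp [this] at h

theorem residuePart_zero_mul_residuePart_two :
    residuePart 0 eulerSeries * residuePart 2 eulerSeries = -residuePart 1 eulerSeries ^ 2 := by
  have h : residuePart 2 (eulerSeries ^ 3) = 0 := by
    ext n
    rw [coeff_residuePart]
    split_ifs with h
    · exact coeff_pentagonalSeries_cube_eq_zero h
    · simp
  obtain ⟨h0, h1, h2, -, -⟩ := residuePart_eulerSeries_sq
  rw [pow_succ', residuePart_eulerSeries_mul 0] at h
  norm_num [h0, h1, h2] at h
  apply mul_left_cancel₀ residuePart_zero_eulerSeries_ne_zero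
  have h3 : (3 : ℤ⟦X⟧) ≠ 0 := fun h ↦ by simpa [map_ofNat] using congrArg (constantCoeff : ℤ⟦X⟧ →+* ℤ) h
  apply mul_left_cancel₀ h3
  linear_combination h

/-- The negative of the part of the Euler function on exponents `1` modulo `5`. -/
noncomputable abbrev betaSeries : ℤ⟦X⟧ := X * eulerSeries25

theorem residuePart_pow_self_one : residuePart 1 eulerSeries = -betaSeries :=
  residuePart_one_eulerSeries

theorem residuePart_pow_self_two : residuePart 2 (eulerSeries ^ 2) = -betaSeries ^ 2 := by
  obtain ⟨-, -, h2, -, -⟩ := residuePart_eulerSeries_sq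
  rw [h2]
  linear_combination 2 * residuePart_zero_mul_residuePart_two -
    (residuePart 1 eulerSeries - betaSeries) * residuePart_pow_self_one

theorem residuePart_pow_self_three : residuePart 3 (eulerSeries ^ 3) = 5 * betaSeries ^ 3 := by
  obtain ⟨-, h1, h2, h3, -⟩ := residuePart_eulerSeries_sq
  rw [pow_succ', residuePart_eulerSeries_mul 1]
  norm_num only [h1, h2, h3]
  rw [residuePart_pow_self_one]
  have := residuePart_zero_mul_residuePart_two
  rw [residuePart_pow_self_one] at this
  linear_combination (-6 * betaSeries) * this

theorem residuePart_pow_self_four : residuePart 4 (eulerSeries ^ 4) = -5 * betaSeries ^ 4 := by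
  obtain ⟨h0, h1, h2, h3, h4⟩ := residuePart_eulerSeries_sq
  have e2 := residuePart_eulerSeries_mul 0 (eulerSeries ^ 2)
  have e3 := residuePart_eulerSeries_mul 1 (eulerSeries ^ 2)
  have e4 := residuePart_eulerSeries_mul 2 (eulerSeries ^ 2)
  have e5 := residuePart_eulerSeries_mul 2 (eulerSeries ^ 3)
  rw [← pow_succ'] at e2 e3 e4 e5
  norm_num only [h0, h1, h2, h3, h4] at e2 e3 e4 e5
  rw [e5, e2, e3, e4, residuePart_pow_self_one]
  have := residuePart_zero_mul_residuePart_two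
  rw [residuePart_pow_self_one] at this
  linear_combination (6 * (residuePart 0 eulerSeries * residuePart 2 eulerSeries) +
    6 * betaSeries ^ 2) * this

theorem prod_cyclotomic_five {R : Type*} [CommRing R] {z : R}
    (hz : z ^ 4 + z ^ 3 + z ^ 2 + z + 1 = 0) (A B C : R) :
    ∏ k ∈ range 5, (A + z ^ k * B + z ^ (2 * k) * C) =
      A ^ 5 + B ^ 5 + C ^ 5 - 5 * A * B ^ 3 * C + 5 * A ^ 2 * B * C ^ 2 := by
  simp only [prod_range_succ, prod_range_zero]
  linear_combination ((1)*z^16*A*C^4 + (1)*z^16*B*C^4 + (1)*z^16*C^5 + (1)*z^15*A*B*C^3 + (-1)*z^15*A*C^4 + (1)*z^15*B^2*C^3 + (-1)*z^15*C^5 + (1)*z^14*A^2*C^3 + (1)*z^14*A*B*C^3 + (1)*z^14*A*C^4 + (-1)*z^13*A^2*C^3 + (1)*z^13*A*B^2*C^2 + (-1)*z^13*A*B*C^3 + (-1)*z^13*A*C^4 + (1)*z^13*B^3*C^2 + (1)*z^13*B^2*C^3 + (1)*z^12*A^2*B*C^2 + (1)*z^12*A^2*C^3 + (1)*z^12*A*B^2*C^2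 + (2)*z^12*A*B*C^3 + (1)*z^12*A*C^4 + (1)*z^11*A^2*B*C^2 + (-1)*z^11*A^2*C^3 + (2)*z^11*A*B^2*C^2 + (-1)*z^11*A*B*C^3 + (1)*z^11*B^3*C^2 + (1)*z^11*C^5 + (1)*z^10*A^3*C^2 + (2)*z^10*A^2*C^3 + (1)*z^10*A*B^3*C + (-2)*z^10*A*B^2*C^2 + (1)*z^10*A*B*C^3 + (1)*z^10*B^4*C + (-1)*z^10*C^5 + (-1)*z^9*A^3*C^2 + (1)*z^9*A^2*B^2*C + (-1)*z^9*A^2*C^3 + (1)*z^9*A*B^3*C + (2)*z^9*A*B^2*C^2 + (1)*z^9*A*B*C^3 + (1)*z^8*A^3*C^2 + (1)*z^8*A^2*B^2*C + (1)*z^8*A^2*B*C^2 + (1)*z^8*A^2*C^3 + (1)*z^8*A*B^3*C + (1)*z^8*A*B^2*C^2 + (1)*z^7*A^3*B*C + (-1)*z^7*A^3*C^2 + (2)*z^7*A^2*B^2*C + (-1)*z^7*A^2*C^3 + (1)*z^7*A*B^3*C + (1)*z^7*A*B^2*C^2 + (1)*z^6*A^3*B*C + (2)*z^6*A^3*C^2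 + (-2)*z^6*A^2*B^2*C + (5)*z^6*A^2*B*C^2 + (1)*z^6*A^2*C^3 + (1)*z^6*A*B^4 + (-4)*z^6*A*B^3*C + (1)*z^6*B^5 + (1)*z^6*C^5 + (-1)*z^5*A^3*B*C + (-1)*z^5*A^3*C^2 + (1)*z^5*A^2*B^3 + (2)*z^5*A^2*B^2*C + (-4)*z^5*A^2*B*C^2 + (5)*z^5*A*B^3*C + (-1)*z^5*B^5 + (-1)*z^5*C^5 + (1)*z^4*A^4*C + (2)*z^4*A^3*B*C + (1)*z^4*A^3*C^2 + (1)*z^4*A^2*B^2*C + (1)*z^4*A^2*B*C^2 + (-1)*z^3*A^4*C + (1)*z^3*A^3*B^2 + (-1)*z^3*A^3*B*C + (-1)*z^3*A^3*C^2 + (1)*z^3*A^2*B^3 + (1)*z^3*A^2*B^2*C + (1)*z^2*A^4*C + (1)*z^2*A^3*B*C + (1)*z^2*A^3*C^2 + (-1)*z*A^4*C + (1)*z*A^3*B^2 + (1)*z*A^3*B*C + (5)*z*A^2*B*C^2 + (-5)*z*A*B^3*C + (1)*z*B^5 + (1)*z*C^5 + (1)*A^4*B + (1)*A^4*C + (-5)*A^2*B*C^2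 + (5)*A*B^3*C + (-1)*B^5 + (-1)*C^5) * hz

/-- The norm of a power series over the power series in `X ^ 5`, computed with complex fifth roots
of unity. -/
noncomputable def rootNorm (ζ : ℂ) : ℤ⟦X⟧ →* ℂ⟦X⟧ where
  toFun f := ∏ k ∈ range 5, rescale (ζ ^ k) (PowerSeries.map (Int.castRingHom ℂ) f)
  map_one' := by simp
  map_mul' f g := by simp [prod_mul_distrib]

theorem rootNorm_apply (ζ : ℂ) (f : ℤ⟦X⟧) : rootNorm ζ f =
    ∏ k ∈ range 5, rescale (ζ ^ k) (PowerSeries.map (Int.castRingHom ℂ) f) := rfl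

theorem sum_pow_eq_zero {ζ : ℂ} (hζ : IsPrimitiveRoot ζ 5) :
    ζ ^ 4 + ζ ^ 3 + ζ ^ 2 + ζ + 1 = 0 := by
  have := hζ.geom_sum_eq_zero (by norm_num)
  simp only [sum_range_succ, sum_range_zero] at this
  linear_combination this

theorem C_sum_pow_eq_zero {ζ : ℂ} (hζ : IsPrimitiveRoot ζ 5) :
    (PowerSeries.C ζ) ^ 4 + (PowerSeries.C ζ) ^ 3 + (PowerSeries.C ζ) ^ 2 + (PowerSeries.C ζ) + 1
      = 0 := by
  simpa using congrArg (PowerSeries.C (R := ℂ)) (sum_pow_eq_zero hζ)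

theorem rescale_map_of_supportedOn {ζ : ℂ} (hζ : ζ ^ 5 = 1) {s : ℕ} {f : ℤ⟦X⟧}
    (hf : SupportedOn s f) (k : ℕ) :
    rescale (ζ ^ k) (PowerSeries.map (Int.castRingHom ℂ) f) =
      PowerSeries.C ζ ^ (s * k) * PowerSeries.map (Int.castRingHom ℂ) f := by
  ext n
  rw [coeff_rescale, ← map_pow, coeff_C_mul, coeff_map]
  by_cases h : n % 5 = s % 5
  · have e (m : ℕ) : ζ ^ m = ζ ^ (m % 5) := by
      conv_lhs => rw [← Nat.div_add_mod m 5, pow_add, pow_mul, hζ, one_pow, one_mul]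
    congr 1
    rw [← pow_mul, e, e (s * k), mul_comm, Nat.mul_mod, h, ← Nat.mul_mod]
  · rw [hf n h]
    simp

/-- The norm of the Euler function over the power series in `q ^ 5`. -/
noncomputable abbrev normSeries : ℤ⟦X⟧ :=
  residuePart 0 eulerSeries ^ 5 + 11 * residuePart 1 eulerSeries ^ 5 + residuePart 2 eulerSeries ^ 5

theorem rootNorm_eulerSeries {ζ : ℂ} (hζ : IsPrimitiveRoot ζ 5) :
    rootNorm ζ eulerSeries = PowerSeries.map (Int.castRingHom ℂ) normSeries := by
  have h (k : ℕ) := rescale_map_of_supportedOn hζ.pow_eq_one (supportedOn_residuePart 0 eulerSeries) k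
  have h1 (k : ℕ) := rescale_map_of_supportedOn hζ.pow_eq_one (supportedOn_residuePart 1 eulerSeries) k
  have h2 (k : ℕ) := rescale_map_of_supportedOn hζ.pow_eq_one (supportedOn_residuePart 2 eulerSeries) k
  rw [rootNorm_apply, eulerSeries_eq]
  simp only [map_add, h, h1, h2, zero_mul, one_mul, pow_zero]
  have e := congrArg (PowerSeries.map (Int.castRingHom ℂ)) residuePart_zero_mul_residuePart_two
  rw [prod_cyclotomic_five (C_sum_pow_eq_zero hζ)]
  simp only [map_mul, map_neg, map_pow, map_ofNat] at e ⊢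
  generalize PowerSeries.map (Int.castRingHom ℂ) (residuePart 0 eulerSeries) = A at *
  generalize PowerSeries.map (Int.castRingHom ℂ) (residuePart 1 eulerSeries) = B at *
  generalize PowerSeries.map (Int.castRingHom ℂ) (residuePart 2 eulerSeries) = C at *
  linear_combination (-5 * B ^ 3 + 5 * B * (A * C - B ^ 2)) * e

theorem rootNorm_one_sub_X_pow {ζ : ℂ} (hζ : IsPrimitiveRoot ζ 5) {m : ℕ} (hm : ¬ 5 ∣ m) :
    rootNorm ζ (1 - X ^ m) = 1 - X ^ (5 * m) := by
  have hz := sum_pow_eq_zero (hζ.pow_of_coprime m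
    ((Nat.Prime.coprime_iff_not_dvd (by norm_num)).2 hm).symm)
  have hz := congrArg (PowerSeries.C (R := ℂ)) hz
  simp only [map_add, map_pow, map_one, map_zero] at hz
  rw [rootNorm_apply]
  have := prod_cyclotomic_five hz 1 (-X ^ m) 0
  simp only [map_sub, map_one, map_pow, map_X, rescale_X]
  convert this using 1
  · refine prod_congr rfl fun k _ ↦ ?_
    ring
  · ring

theorem rootNorm_one_sub_X_pow_of_dvd {ζ : ℂ} (hζ : IsPrimitiveRoot ζ 5) (m : ℕ) :
    rootNorm ζ (1 - X ^ (5 * m)) = (1 - X ^ (5 * m)) ^ 5 := by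
  rw [rootNorm_apply]
  have h : (PowerSeries.C ζ) ^ 5 = 1 := by rw [← map_pow, hζ.pow_eq_one, map_one]
  have h (k : ℕ) : ((PowerSeries.C ζ) ^ k) ^ (5 * m) = 1 := by
    rw [← pow_mul, mul_comm, mul_assoc, pow_mul, h, one_pow]
  simp [rescale_X, mul_pow, h]

theorem rootNorm_qPoch {ζ : ℂ} (hζ : IsPrimitiveRoot ζ 5) (N : ℕ) :
    rootNorm ζ (qPoch (5 * N)) * PowerSeries.map (Int.castRingHom ℂ)
      (expand 5 (by norm_num) (expand 5 (by norm_num) (qPoch N))) =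
    PowerSeries.map (Int.castRingHom ℂ) (expand 5 (by norm_num) (qPoch (5 * N)) *
      expand 5 (by norm_num) (qPoch N) ^ 5) := by
  induction N with
  | zero => simp
  | succ N ih =>
    have e : qPoch (5 * (N + 1)) = qPoch (5 * N) * (1 - X ^ (5 * N + 1)) * (1 - X ^ (5 * N + 2)) *
      (1 - X ^ (5 * N + 3)) * (1 - X ^ (5 * N + 4)) * (1 - X ^ (5 * (N + 1))) := by
      rw [show 5 * (N + 1) = 5 * N + 4 + 1 by ring]
      simp only [qPoch_succ]
    rw [e, qPoch_succ]
    simp only [map_mul, rootNorm_one_sub_X_pow_of_dvd hζ]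
    rw [rootNorm_one_sub_X_pow hζ (by omega), rootNorm_one_sub_X_pow hζ (by omega),
      rootNorm_one_sub_X_pow hζ (by omega), rootNorm_one_sub_X_pow hζ (by omega)]
    simp only [map_mul, map_sub, map_pow, map_one, expand_X, map_X, ← pow_mul] at ih ⊢
    linear_combination (1 - X ^ (5 * (5 * N + 1))) * (1 - X ^ (5 * (5 * N + 2))) *
      (1 - X ^ (5 * (5 * N + 3))) * (1 - X ^ (5 * (5 * N + 4))) * (1 - X ^ (5 * (N + 1))) ^ 5 *
      (1 - X ^ (5 * (5 * (N + 1)))) * ih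

theorem eq_of_forall_X_pow_dvd_sub {R : Type*} [CommRing R] {f g : R⟦X⟧}
    (h : ∀ n : ℕ, X ^ (n + 1) ∣ f - g) : f = g := by
  ext n
  have := X_pow_dvd_iff.1 (h n) n (by omega)
  rwa [map_sub, sub_eq_zero] at this

theorem X_pow_dvd_expand {n : ℕ} {f : ℤ⟦X⟧} (h : X ^ n ∣ f) :
    X ^ n ∣ expand 5 (by norm_num) f := by
  obtain ⟨g, rfl⟩ := h
  rw [map_mul, map_pow, expand_X, ← pow_mul]
  exact Dvd.dvd.mul_right (pow_dvd_pow _ (by omega)) _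

theorem normSeries_mul_eulerSeries25 : normSeries * eulerSeries25 = eulerSeries5 ^ 6 := by
  obtain ⟨ζ, hζ⟩ : ∃ ζ : ℂ, IsPrimitiveRoot ζ 5 := ⟨_, Complex.isPrimitiveRoot_exp 5 (by norm_num)⟩
  have hinj : Function.Injective (PowerSeries.map (Int.castRingHom ℂ)) :=
    PowerSeries.map_injective _ Int.cast_injective
  apply hinj
  rw [map_mul, ← rootNorm_eulerSeries hζ]
  apply eq_of_forall_X_pow_dvd_sub
  intro N
  have h5 : (X : ℤ⟦X⟧) ^ (N + 1) ∣ eulerSeries - qPoch (5 * N) :=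
    (pow_dvd_pow _ (by omega)).trans (X_pow_dvd_pentagonalSeries_sub (5 * N))
  have h1 : (X : ℤ⟦X⟧) ^ (N + 1) ∣ eulerSeries - qPoch N := X_pow_dvd_pentagonalSeries_sub N
  have hm {f : ℤ⟦X⟧} (h : X ^ (N + 1) ∣ f) :
      X ^ (N + 1) ∣ PowerSeries.map (Int.castRingHom ℂ) f := by
    simpa using map_dvd (PowerSeries.map (Int.castRingHom ℂ)) h
  have key := rootNorm_qPoch hζ N
  let q := Ideal.Quotient.mk (Ideal.span {(X : ℂ⟦X⟧) ^ (N + 1)})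
  have hq {f g : ℂ⟦X⟧} : q f = q g ↔ X ^ (N + 1) ∣ f - g := by
    rw [Ideal.Quotient.eq, Ideal.mem_span_singleton]
  rw [← hq]
  have key := congrArg q key
  rw [map_mul, map_mul, map_mul, map_pow, map_pow, rootNorm_apply, map_prod] at key
  have e1 := hq.2 (by simpa only [map_sub] using hm (X_pow_dvd_expand h5))
  have e2 := hq.2 (by simpa only [map_sub] using hm (X_pow_dvd_expand h1))
  have e3 := hq.2 (by simpa only [map_sub] using hm (X_pow_dvd_expand (X_pow_dvd_expand h1)))
  have e4 (k : ℕ) : q (rescale (ζ ^ k) (PowerSeries.map (Int.castRingHom ℂ) eulerSeries)) =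
      q (rescale (ζ ^ k) (PowerSeries.map (Int.castRingHom ℂ) (qPoch (5 * N)))) := by
    rw [hq, ← map_sub, ← map_sub]
    obtain ⟨g, hg⟩ := hm h5
    rw [hg, map_mul, map_pow, rescale_X, mul_pow]
    exact Dvd.intro (PowerSeries.C (ζ ^ k) ^ (N + 1) * rescale (ζ ^ k) g) (by ring)
  simp only [← e1, ← e2, ← e3, ← e4] at key
  rw [map_mul, rootNorm_apply, map_prod, key, map_pow, map_pow]
  ring

theorem normSeries_eq : normSeries = eulerSeries ^ 5 + 5 * betaSeries * eulerSeries ^ 4 +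
    15 * betaSeries ^ 2 * eulerSeries ^ 3 + 25 * betaSeries ^ 3 * eulerSeries ^ 2 +
    25 * betaSeries ^ 4 * eulerSeries := by
  have h := residuePart_zero_mul_residuePart_two
  have hb : betaSeries = -residuePart 1 eulerSeries := by rw [residuePart_pow_self_one, neg_neg]
  have e := eulerSeries_eq
  unfold normSeries
  rw [hb]
  generalize residuePart 0 eulerSeries = a at *
  generalize residuePart 1 eulerSeries = b at *
  generalize residuePart 2 eulerSeries = c at *
  rw [e]
  linear_combination ((-5)*a^3 + (-10)*a^2*c + (-5)*a*b^2 + (-10)*a*c^2 + (-5)*b^2*c + (-5)*c^3) * h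

theorem supportedOn_intCast (a : ℤ) : SupportedOn 0 (a : ℤ⟦X⟧) := by
  intro n hn
  rw [← map_intCast (PowerSeries.C (R := ℤ)) a, PowerSeries.coeff_C, if_neg]
  rintro rfl
  exact hn rfl

theorem supportedOn_X_pow (j : ℕ) : SupportedOn j (X ^ j : ℤ⟦X⟧) := by
  intro n hn
  rw [coeff_X_pow, if_neg]
  rintro rfl
  exact hn rfl

theorem residuePart_monomial_mul (a : ℤ) (r j : ℕ) (g f : ℤ⟦X⟧) :
    residuePart (r + j) ((a : ℤ⟦X⟧) * X ^ j * expand 5 (by norm_num) g * f) =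
      (a : ℤ⟦X⟧) * X ^ j * expand 5 (by norm_num) g * residuePart r f :=
  residuePart_mul ((((supportedOn_intCast a).mul (supportedOn_X_pow j)).mul
    (supportedOn_expand g)).congr (by omega)) r f

theorem supportedOn_betaSeries : SupportedOn 1 betaSeries := by
  have := (supportedOn_X_pow 1).mul (supportedOn_expand eulerSeries5)
  simpa using this

theorem supportedOn_normSeries : SupportedOn 0 normSeries := by
  refine SupportedOn.add (SupportedOn.add ?_ ?_) ?_
  · exact ((supportedOn_residuePart 0 eulerSeries).pow 5).congr rfl
  · exact ((supportedOn_intCast 11).mul ((supportedOn_residuePart 1 eulerSeries).pow 5)).congr rfl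
  · exact ((supportedOn_residuePart 2 eulerSeries).pow 5).congr rfl

/-- The modular equation of degree five for the Euler function, applied to a residue class of
exponents. -/
theorem normSeries_mul_residuePart (r : ℕ) (f : ℤ⟦X⟧) :
    normSeries * residuePart r f = residuePart (r + 5) (eulerSeries ^ 5 * f) +
      5 * betaSeries * residuePart (r + 4) (eulerSeries ^ 4 * f) +
      15 * betaSeries ^ 2 * residuePart (r + 3) (eulerSeries ^ 3 * f) +
      25 * betaSeries ^ 3 * residuePart (r + 2) (eulerSeries ^ 2 * f) +
      25 * betaSeries ^ 4 * residuePart (r + 1) (eulerSeries * f) := by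
  have key (a : ℤ) (j k : ℕ) (g : ℤ⟦X⟧) : residuePart (k + j) (a * betaSeries ^ j * g) =
      a * betaSeries ^ j * residuePart k g :=
    residuePart_mul (((supportedOn_intCast a).mul (supportedOn_betaSeries.pow j)).congr
      (by omega)) k g
  have h := residuePart_mul supportedOn_normSeries r f
  rw [add_zero] at h
  have h1 := key 5 1 (r + 4) (eulerSeries ^ 4 * f)
  have h2 := key 15 2 (r + 3) (eulerSeries ^ 3 * f)
  have h3 := key 25 3 (r + 2) (eulerSeries ^ 2 * f)
  have h4 := key 25 4 (r + 1) (eulerSeries * f)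
  simp only [Int.cast_ofNat, pow_one, add_assoc, Nat.reduceAdd] at h1 h2 h3 h4
  rw [← h, ← h1, ← h2, ← h3, ← h4, normSeries_eq, ← residuePart_add_five, ← map_add, ← map_add,
    ← map_add, ← map_add]
  congr 1
  ring

theorem residuePart_pow_self_zero : residuePart 0 (eulerSeries ^ 0) = 1 := by
  rw [pow_zero, residuePart_one]

theorem residuePart_pow_self_add_five (n : ℕ) :
    residuePart (n + 5) (eulerSeries ^ (n + 5)) = normSeries * residuePart n (eulerSeries ^ n) -
      5 * betaSeries * residuePart (n + 4) (eulerSeries ^ (n + 4)) -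
      15 * betaSeries ^ 2 * residuePart (n + 3) (eulerSeries ^ (n + 3)) -
      25 * betaSeries ^ 3 * residuePart (n + 2) (eulerSeries ^ (n + 2)) -
      25 * betaSeries ^ 4 * residuePart (n + 1) (eulerSeries ^ (n + 1)) := by
  rw [normSeries_mul_residuePart]
  simp only [← pow_add, ← pow_succ']
  simp only [add_comm n]
  ring

theorem residuePart_pow_self_eight_and_fourteen :
    residuePart 8 (eulerSeries ^ 8) = -125 * betaSeries ^ 8 ∧
    residuePart 14 (eulerSeries ^ 14) = -15625 * betaSeries ^ 14 := by
  have h0 := residuePart_pow_self_zero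
  have h1 := residuePart_pow_self_one
  have h2 := residuePart_pow_self_two
  have h3 := residuePart_pow_self_three
  have h4 := residuePart_pow_self_four
  rw [← pow_one eulerSeries] at h1
  have h5 := residuePart_pow_self_add_five 0
  have h6 := residuePart_pow_self_add_five 1
  have h7 := residuePart_pow_self_add_five 2
  have h8 := residuePart_pow_self_add_five 3
  have h9 := residuePart_pow_self_add_five 4
  have h10 := residuePart_pow_self_add_five 5
  have h11 := residuePart_pow_self_add_five 6
  have h12 := residuePart_pow_self_add_five 7
  have h13 := residuePart_pow_self_add_five 8
  have h14 := residuePart_pow_self_add_five 9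
  simp only [Nat.reduceAdd, zero_add] at h5 h6 h7 h8 h9 h10 h11 h12 h13 h14
  generalize normSeries = D at *
  generalize betaSeries = b at *
  rw [h0, h1, h2, h3, h4] at h5
  ring_nf at h5
  rw [h1, h2, h3, h4, h5] at h6
  ring_nf at h6
  rw [h2, h3, h4, h5, h6] at h7
  ring_nf at h7
  rw [h3, h4, h5, h6, h7] at h8
  ring_nf at h8
  rw [h4, h5, h6, h7, h8] at h9
  ring_nf at h9
  rw [h5, h6, h7, h8, h9] at h10
  ring_nf at h10
  rw [h6, h7, h8, h9, h10] at h11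
  ring_nf at h11
  rw [h7, h8, h9, h10, h11] at h12
  ring_nf at h12
  rw [h8, h9, h10, h11, h12] at h13
  ring_nf at h13
  rw [h9, h10, h11, h12, h13] at h14
  ring_nf at h14
  rw [h8, h14]
  constructor <;> ring

theorem residuePart_inverse_pow_four {u : ℤ⟦X⟧} (hu : eulerSeries * u = 1) :
    normSeries ^ 4 * residuePart 1 (u ^ 4) = 4 * normSeries ^ 3 * betaSeries +
      550 * normSeries ^ 2 * betaSeries ^ 6 + 12500 * normSeries * betaSeries ^ 11 +
      78125 * betaSeries ^ 16 := by
  have e (a b : ℕ) : eulerSeries ^ (a + b) * u ^ a = eulerSeries ^ b := by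
    rw [pow_add, mul_right_comm, ← mul_pow, hu, one_pow, one_mul]
  have e' (a b : ℕ) : eulerSeries ^ a * u ^ (a + b) = u ^ b := by
    rw [pow_add, ← mul_assoc, ← mul_pow, hu, one_pow, one_mul]
  have h0 := residuePart_pow_self_zero
  have h1 := residuePart_pow_self_one
  have h2 := residuePart_pow_self_two
  have h3 := residuePart_pow_self_three
  have h4 := residuePart_pow_self_four
  have p (r : ℕ) (f : ℤ⟦X⟧) := congrArg (fun F ↦ F f) (residuePart_add_five r)
  have g1 := normSeries_mul_residuePart 4 (u ^ 1)
  rw [e 1 4, e 1 3, e 1 2, e 1 1, ← pow_one eulerSeries, ← pow_mul, ← pow_mul, ← pow_mul, ← pow_mul,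
    e 1 0] at g1
  have g2 := normSeries_mul_residuePart 3 (u ^ 2)
  rw [e 2 3, e 2 2, e 2 1, e 2 0, ← pow_one eulerSeries, ← pow_mul, ← pow_mul,
    e' 1 1] at g2
  have g3 := normSeries_mul_residuePart 2 (u ^ 3)
  rw [e 3 2, e 3 1, e 3 0, e' 2 1, ← pow_one eulerSeries, ← pow_mul,
    e' 1 2] at g3
  have g4 := normSeries_mul_residuePart 1 (u ^ 4)
  rw [e 4 1, e 4 0, e' 3 1, e' 2 2, ← pow_one eulerSeries,
    e' 1 3] at g4
  simp only [Nat.reduceAdd, one_mul, pow_one, pow_zero] at g1 g2 g3 g4 h0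
  have p5 := p 0
  have p6 := p 1
  have p7 := p 2
  have p8 := p 3
  have p9 := p 4
  norm_num only at p5 p6 p7 p8 p9
  simp only [p5, p6, p7, p8, p9, h0, h1, h2, h3, h4] at g1 g2 g3 g4
  generalize normSeries = D at *
  generalize betaSeries = b at *
  generalize residuePart 4 u = u1 at *
  generalize residuePart 3 (u ^ 2) = u2 at *
  generalize residuePart 2 (u ^ 3) = u3 at *
  generalize residuePart 1 (u ^ 4) = u4 at *
  have g1 : D * u1 = 5 * b ^ 4 := by linear_combination g1
  have g2 : D * u2 = 10 * b ^ 3 + 25 * b ^ 4 * u1 := by linear_combination g2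
  have g3 : D * u3 = 9 * b ^ 2 + 25 * b ^ 3 * u1 + 25 * b ^ 4 * u2 := by linear_combination g3
  have g4 : D * u4 = 4 * b + 15 * b ^ 2 * u1 + 25 * b ^ 3 * u2 + 25 * b ^ 4 * u3 := by
    linear_combination g4
  linear_combination D ^ 3 * g4 + (25 * b ^ 4 * D ^ 2) * g3 +
    (25 * b ^ 3 * D ^ 2 + 625 * b ^ 8 * D) * g2 +
    (15 * b ^ 2 * D ^ 2 + 625 * b ^ 7 * D + 625 * b ^ 7 * D + 15625 * b ^ 12) * g1

theorem dvd_coeff_sub_coeff {r : ℕ} {f G K : ℤ⟦X⟧} {a : ℤ}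
    (h : residuePart r f = X ^ r * expand 5 (by norm_num) G + (a : ℤ⟦X⟧) * K) (n : ℕ) :
    a ∣ coeff (5 * n + r) f - coeff n G := by
  have h := congrArg (coeff (5 * n + r)) h
  rw [coeff_residuePart, if_pos (by omega), map_add, coeff_X_pow_mul, coeff_expand_mul,
    ← map_intCast (PowerSeries.C (R := ℤ)) a, coeff_C_mul] at h
  rw [h]
  exact ⟨coeff (5 * n + r) K, by simp⟩

theorem dvd_coeff_core_pow_four {u : ℤ⟦X⟧} (hu : eulerSeries * u = 1) (n : ℕ) :
    15625 ∣ coeff (125 * n + 121) ((eulerSeries5 ^ 5 * u) ^ 4) := by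
  obtain ⟨h8, h14⟩ := residuePart_pow_self_eight_and_fourteen
  have h2 := residuePart_pow_self_two
  have p8 : residuePart 3 (eulerSeries ^ 8) = -125 * betaSeries ^ 8 := by
    rw [← h8, ← residuePart_add_five 3]
  have p14 : residuePart 4 (eulerSeries ^ 14) = -15625 * betaSeries ^ 14 := by
    rw [← h14]
    exact (DFunLike.congr_fun ((residuePart_add_five 9).trans (residuePart_add_five 4)) _).symm
  have hU : eulerSeries5 * expand 5 (by norm_num) u = 1 := by
    rw [← map_mul, hu, map_one]
  have s1 : residuePart 1 ((eulerSeries5 ^ 5 * u) ^ 4) = X ^ 1 * expand 5 (by norm_num)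
      (4 * eulerSeries5 ^ 2 * eulerSeries ^ 14 + 550 * X * eulerSeries5 ^ 8 * eulerSeries ^ 8 +
        12500 * X ^ 2 * eulerSeries5 ^ 14 * eulerSeries ^ 2) +
        ((15625 : ℤ) : ℤ⟦X⟧) * (5 * X ^ 16 * eulerSeries25 ^ 20 * (expand 5 (by norm_num) u) ^ 4) := by
    have e := residuePart_monomial_mul 1 1 0 (eulerSeries ^ 20) (u ^ 4)
    have g := residuePart_inverse_pow_four hu
    have k := normSeries_mul_eulerSeries25
    simp only [Int.cast_one, one_mul, pow_zero, add_zero] at e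
    rw [mul_pow, ← pow_mul, ← map_pow, e]
    simp only [map_add, map_mul, map_pow, map_ofNat, expand_X]
    apply (isUnit_iff_exists_inv.2 ⟨_, hU⟩ |>.pow 4).mul_left_cancel
    unfold betaSeries eulerSeries25 eulerSeries5 at *
    generalize normSeries = D at *
    generalize residuePart 1 (u ^ 4) = v at *
    generalize expand 5 (by norm_num) u = U at *
    generalize expand 5 (by norm_num) (expand 5 (by norm_num) eulerSeries) = G at *
    generalize expand 5 (by norm_num) eulerSeries = F at *
    have hU4 : F ^ 4 * U ^ 4 = 1 := by rw [← mul_pow, hU, one_pow]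
    push_cast
    have k2 : D ^ 2 * G ^ 2 = F ^ 12 := by rw [← mul_pow, k, ← pow_mul]
    have k3 : D ^ 3 * G ^ 3 = F ^ 18 := by rw [← mul_pow, k, ← pow_mul]
    have k4 : D ^ 4 * G ^ 4 = F ^ 24 := by rw [← mul_pow, k, ← pow_mul]
    linear_combination G ^ 4 * g - v * k4 + 4 * X * G ^ 2 * k3 + 550 * X ^ 6 * G ^ 8 * k2 +
      12500 * X ^ 11 * G ^ 14 * k - 78125 * X ^ 16 * G ^ 20 * hU4
  have s2 : residuePart 4 (4 * eulerSeries5 ^ 2 * eulerSeries ^ 14 +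
      550 * X * eulerSeries5 ^ 8 * eulerSeries ^ 8 +
        12500 * X ^ 2 * eulerSeries5 ^ 14 * eulerSeries ^ 2) =
      X ^ 4 * expand 5 (by norm_num) (-68750 * X * eulerSeries5 ^ 8 * eulerSeries ^ 8 -
        12500 * eulerSeries5 ^ 2 * eulerSeries ^ 14) +
      ((15625 : ℤ) : ℤ⟦X⟧) * (-4 * eulerSeries5 ^ 2 * betaSeries ^ 14) := by
    have e1 := residuePart_monomial_mul 4 4 0 (eulerSeries ^ 2) (eulerSeries ^ 14)
    have e2 := residuePart_monomial_mul 550 3 1 (eulerSeries ^ 8) (eulerSeries ^ 8)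
    have e3 := residuePart_monomial_mul 12500 2 2 (eulerSeries ^ 14) (eulerSeries ^ 2)
    rw [p14] at e1
    rw [p8] at e2
    rw [h2] at e3
    simp only [Int.cast_ofNat, pow_zero, mul_one, pow_one, add_zero, Nat.reduceAdd, map_pow]
      at e1 e2 e3
    rw [map_add, map_add, e1, e2, e3, betaSeries]
    simp only [map_sub, map_mul, map_pow, map_ofNat, map_neg, expand_X]
    push_cast
    ring
  have s3 : residuePart 4 (-68750 * X * eulerSeries5 ^ 8 * eulerSeries ^ 8 -
        12500 * eulerSeries5 ^ 2 * eulerSeries ^ 14) = X ^ 4 * expand 5 (by norm_num) 0 +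
      ((15625 : ℤ) : ℤ⟦X⟧) * (550 * X * eulerSeries5 ^ 8 * betaSeries ^ 8 +
        12500 * eulerSeries5 ^ 2 * betaSeries ^ 14) := by
    have e1 := residuePart_monomial_mul 12500 4 0 (eulerSeries ^ 2) (eulerSeries ^ 14)
    have e2 := residuePart_monomial_mul (-68750) 3 1 (eulerSeries ^ 8) (eulerSeries ^ 8)
    rw [p14] at e1
    rw [p8] at e2
    simp only [Int.cast_ofNat, Int.cast_neg, pow_zero, mul_one, pow_one, add_zero, Nat.reduceAdd,
      map_pow] at e1 e2
    rw [map_sub, e1, e2, map_zero]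
    push_cast
    ring
  have d1 := dvd_coeff_sub_coeff s1 (25 * n + 24)
  have d2 := dvd_coeff_sub_coeff s2 (5 * n + 4)
  have d3 := dvd_coeff_sub_coeff s3 n
  rw [map_zero, sub_zero] at d3
  rw [show 5 * (25 * n + 24) + 1 = 125 * n + 121 by ring] at d1
  rw [show 5 * (5 * n + 4) + 4 = 25 * n + 24 by ring] at d2
  have := (d1.add d2).add d3
  simpa using this

/-- The generating function of the `t`-core partitions. -/
noncomputable def coreSeries (t : ℕ) : ℤ⟦X⟧ :=
  PowerSeries.mk fun m ↦ (Nat.card {p : m.Partition // IsTCore t p} : ℤ)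

/-- Tuples of `t`-cores correspond to a tuple of sizes together with a `t`-core of each size. -/
def coreTupleEquiv (t k n : ℕ) :
    { f : Fin k → Σ m : Fin (n + 1), Nat.Partition (m : ℕ) //
      (∑ i, ((f i).1 : ℕ)) = n ∧ ∀ i, IsTCore t (f i).2 } ≃
    Σ l : { l : Fin k → Fin (n + 1) // ∑ i, (l i : ℕ) = n },
      ∀ i, {p : (l.1 i : ℕ).Partition // IsTCore t p} where
  toFun f := ⟨⟨fun i ↦ (f.1 i).1, f.2.1⟩, fun i ↦ ⟨(f.1 i).2, f.2.2 i⟩⟩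
  invFun g := ⟨fun i ↦ ⟨g.1.1 i, (g.2 i).1⟩, g.1.2, fun i ↦ (g.2 i).2⟩
  left_inv _ := rfl
  right_inv _ := rfl

theorem numA_eq_coeff (t k n : ℕ) : (numA t k n : ℤ) = coeff n (coreSeries t ^ k) := by
  rw [numA, Nat.card_congr (coreTupleEquiv t k n), Nat.card_sigma]
  simp only [Nat.card_pi]
  rw [← Fin.prod_const, PowerSeries.coeff_prod]
  push_cast
  refine sum_bij (fun l _ ↦ Finsupp.equivFunOnFinite.symm fun i ↦ (l.1 i : ℕ)) ?_ ?_ ?_ ?_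
  · intro l _
    simpa [mem_finsuppAntidiag] using l.2
  · intro l _ l' _ h
    ext i
    exact DFunLike.congr_fun h i
  · intro b hb
    have hb : ∑ i, b i = n := by simpa [mem_finsuppAntidiag] using hb
    have hle (i : Fin k) : b i < n + 1 := by
      rw [Nat.lt_succ_iff, ← hb]
      exact single_le_sum (f := fun i ↦ b i) (fun _ _ ↦ Nat.zero_le _) (mem_univ i)
    refine ⟨⟨fun i ↦ ⟨b i, hle i⟩, hb⟩, mem_univ _, ?_⟩
    ext i
    rfl
  · intro l _
    simp [coreSeries]

theorem five_dvd_pow_five_sub_expand (P : ℤ⟦X⟧) :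
    ((5 : ℕ) : ℤ⟦X⟧) ∣ P ^ 5 - expand 5 (by norm_num) P := by
  have : Fact (Nat.Prime 5) := ⟨by norm_num⟩
  have h := MvPowerSeries.map_frobenius_expand 5 (by norm_num)
    (f := PowerSeries.map (Int.castRingHom (ZMod 5)) P)
  have h' : expand 5 (by norm_num) (PowerSeries.map (Int.castRingHom (ZMod 5)) P) =
      PowerSeries.map (Int.castRingHom (ZMod 5)) P ^ 5 := by
    rw [← h, ZMod.frobenius_zmod]
    exact (DFunLike.congr_fun MvPowerSeries.map_id _).symm
  rw [← PowerSeries.map_expand, ← map_pow, eq_comm, ← sub_eq_zero, ← map_sub] at h'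
  rw [← map_natCast (PowerSeries.C (R := ℤ))]
  generalize P ^ 5 - expand 5 _ P = Q at h'
  have hd (n : ℕ) : ∃ c : ℤ, coeff n Q = 5 * c := by
    have := congrArg (coeff n) h'
    rw [coeff_map, map_zero] at this
    exact (ZMod.intCast_zmod_eq_zero_iff_dvd _ 5).1 (by simpa using this)
  choose c hc using hd
  refine ⟨PowerSeries.mk c, ?_⟩
  ext n
  rw [coeff_C_mul, coeff_mk, hc]
  simp

theorem dvd_pow_sub_expand_pow (P : ℤ⟦X⟧) (s : ℕ) :
    ((5 : ℕ) : ℤ⟦X⟧) ^ (s + 1) ∣ P ^ 5 ^ (s + 1) - expand 5 (by norm_num) P ^ 5 ^ s := by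
  rw [pow_succ' 5 s, pow_mul]
  exact dvd_sub_pow_of_dvd_sub (five_dvd_pow_five_sub_expand P) s

theorem dvd_pow_sub_expand_expand_expand (P : ℤ⟦X⟧) :
    ((5 : ℕ) : ℤ⟦X⟧) ^ 6 ∣ P ^ 5 ^ 8 - expand 5 (by norm_num) (expand 5 (by norm_num)
      (expand 5 (by norm_num) (P ^ 5 ^ 5))) := by
  have h1 := dvd_pow_sub_expand_pow P 7
  have h2 := dvd_pow_sub_expand_pow (expand 5 (by norm_num) P) 6
  have h3 := dvd_pow_sub_expand_pow (expand 5 (by norm_num) (expand 5 (by norm_num) P)) 5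
  have h1 := (pow_dvd_pow ((5 : ℕ) : ℤ⟦X⟧) (by norm_num : 6 ≤ 7 + 1)).trans h1
  have h2 := (pow_dvd_pow ((5 : ℕ) : ℤ⟦X⟧) (by norm_num : 6 ≤ 6 + 1)).trans h2
  have := (h1.add h2).add h3
  rw [sub_add_sub_cancel, sub_add_sub_cancel] at this
  simpa only [map_pow] using this

theorem dvd_coeff_of_pow_dvd {f g : ℤ⟦X⟧} (h : ((5 : ℕ) : ℤ⟦X⟧) ^ 6 ∣ f - g) {n : ℕ}
    (hg : 15625 ∣ coeff n g) : 15625 ∣ coeff n f := by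
  obtain ⟨K, hK⟩ := h
  have := congrArg (coeff n) hK
  rw [← map_natCast (PowerSeries.C (R := ℤ)), ← map_pow, coeff_C_mul, map_sub] at this
  norm_num at this
  omega

theorem dvd_coeff_mul_expand {f : ℤ⟦X⟧} (h : ∀ n, 15625 ∣ coeff (125 * n + 121) f) (g : ℤ⟦X⟧)
    (n : ℕ) : 15625 ∣ coeff (125 * n + 121) (f * expand 5 (by norm_num) (expand 5 (by norm_num)
      (expand 5 (by norm_num) g))) := by
  rw [coeff_mul]
  refine dvd_sum fun p hp ↦ ?_
  have hp := HasAntidiagonal.mem_antidiagonal.1 hp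
  by_cases hd : 125 ∣ p.2
  · obtain ⟨m, hm⟩ : ∃ m, p.1 = 125 * m + 121 := ⟨p.1 / 125, by omega⟩
    rw [hm]
    exact (h m).mul_right _
  · convert dvd_zero _
    simp only [coeff_expand]
    split_ifs <;> omega

theorem dvd_numA {u : ℤ⟦X⟧} (hu : eulerSeries * u = 1) (hc : coreSeries 5 = eulerSeries5 ^ 5 * u)
    (i n : ℕ) : 15625 ∣ numA 5 (390625 * i + 4) (125 * n + 121) := by
  have key : (15625 : ℤ) ∣ coeff (125 * n + 121) (coreSeries 5 ^ (390625 * i + 4)) := by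
    have h4 (n : ℕ) : 15625 ∣ coeff (125 * n + 121) (coreSeries 5 ^ 4) := by
      rw [hc]
      exact dvd_coeff_core_pow_four hu n
    refine dvd_coeff_of_pow_dvd ?_ (dvd_coeff_mul_expand h4 ((coreSeries 5 ^ 5 ^ 5) ^ i) n)
    rw [add_comm, pow_add, ← mul_sub, show 390625 = 5 ^ 8 by norm_num, pow_mul]
    refine Dvd.dvd.mul_left ?_ _
    rw [map_pow, map_pow, map_pow]
    exact (dvd_pow_sub_expand_expand_expand _).trans (sub_dvd_pow_sub_pow _ _ i)
  rw [← numA_eq_coeff] at key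
  exact_mod_cast key

theorem card_choose_two_le_sum (B : Finset ℕ) : (#B).choose 2 ≤ ∑ b ∈ B, b := by
  induction B using Finset.induction_on_max with
  | empty => simp
  | insert a s hs ih =>
    have ha : a ∉ s := fun h ↦ (hs a h).ne rfl
    have hc : #s ≤ a := by
      simpa using card_le_card (fun x hx ↦ mem_range.2 (hs x hx) : s ⊆ range a)
    rw [card_insert_of_notMem ha, sum_insert ha, Nat.choose_succ_succ' _ 1, Nat.choose_one_right, one_add_one_eq_two]
    omega

/-- The set of natural numbers, closed under subtraction of `t`, with `n r` elements in the residue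
class of `r` modulo `t`. -/
def runnerSet (t : ℕ) (n : ℕ →₀ ℕ) : Finset ℕ :=
  ((range t).sigma fun r ↦ range (n r)).image fun p ↦ p.1 + t * p.2

theorem runnerSet_injOn (t : ℕ) (n : ℕ →₀ ℕ) :
    Set.InjOn (fun p : (_ : ℕ) × ℕ ↦ p.1 + t * p.2) ((range t).sigma fun r ↦ range (n r)) := by
  rintro ⟨r, y⟩ h ⟨r', y'⟩ h' e
  simp only [coe_sigma, Set.mem_sigma_iff, mem_coe, mem_range] at h h' e
  have hr : r = r' := by
    have := congrArg (· % t) e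
    simpa [Nat.mod_eq_of_lt h.1, Nat.mod_eq_of_lt h'.1] using this
  subst hr
  have : y = y' := Nat.eq_of_mul_eq_mul_left (by omega : 0 < t) (by omega)
  rw [this]

theorem mem_runnerSet {t : ℕ} (ht : 0 < t) {n : ℕ →₀ ℕ} {x : ℕ} :
    x ∈ runnerSet t n ↔ x / t < n (x % t) := by
  simp only [runnerSet, mem_image, mem_sigma, mem_range, Sigma.exists]
  constructor
  · rintro ⟨r, y, ⟨hr, hy⟩, rfl⟩
    rwa [Nat.add_mul_mod_self_left, Nat.mod_eq_of_lt hr, Nat.add_mul_div_left _ _ ht,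
      Nat.div_eq_of_lt hr, zero_add]
  · intro h
    exact ⟨x % t, x / t, ⟨Nat.mod_lt _ ht, h⟩, Nat.mod_add_div x t⟩

theorem card_runnerSet (t : ℕ) (n : ℕ →₀ ℕ) : #(runnerSet t n) = ∑ r ∈ range t, n r := by
  rw [runnerSet, card_image_of_injOn (runnerSet_injOn t n), card_sigma]
  simp

/-- The sum of the elements of `runnerSet t n`. -/
def runnerSum (t : ℕ) (n : ℕ →₀ ℕ) : ℕ := ∑ r ∈ range t, (r * n r + t * (n r).choose 2)

theorem sum_runnerSet (t : ℕ) (n : ℕ →₀ ℕ) : ∑ b ∈ runnerSet t n, b = runnerSum t n := by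
  rw [runnerSet, sum_image (runnerSet_injOn t n), sum_sigma, runnerSum]
  refine sum_congr rfl fun r _ ↦ ?_
  rw [sum_add_distrib, ← mul_sum, sum_range_id, Nat.choose_two_right]
  simp [mul_comm]

theorem choose_two_le_runnerSum (t : ℕ) (n : ℕ →₀ ℕ) :
    (∑ r ∈ range t, n r).choose 2 ≤ runnerSum t n := by
  rw [← sum_runnerSet, ← card_runnerSet]
  exact card_choose_two_le_sum _

theorem choose_two_add_le_runnerSum {t r : ℕ} (hr : r < t) (n : ℕ →₀ ℕ) :
    (∑ r ∈ range t, n r).choose 2 + ∑ r ∈ range t, n r ≤ runnerSum t n + (r + t * n r) := by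
  have hy : r + t * n r ∉ runnerSet t n := by
    have ht : 0 < t := by omega
    rw [mem_runnerSet ht, Nat.add_mul_mod_self_left, Nat.mod_eq_of_lt hr,
      Nat.add_mul_div_left _ _ ht, Nat.div_eq_of_lt hr, zero_add]
    exact lt_irrefl _
  have := card_choose_two_le_sum (insert (r + t * n r) (runnerSet t n))
  rw [card_insert_of_notMem hy, sum_insert hy, Nat.choose_succ_succ' _ 1, Nat.choose_one_right,
    one_add_one_eq_two, sum_runnerSet, card_runnerSet] at this
  omega

/-- A finite set of natural numbers is closed under subtraction of `t`. -/
def IsSubClosed (t : ℕ) (B : Finset ℕ) : Prop := ∀ b ∈ B, t ≤ b → b - t ∈ B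

theorem isSubClosed_runnerSet {t : ℕ} (ht : 0 < t) (n : ℕ →₀ ℕ) :
    IsSubClosed t (runnerSet t n) := by
  intro b hb hbt
  obtain ⟨c, rfl⟩ := Nat.exists_eq_add_of_le' hbt
  rw [mem_runnerSet ht, Nat.add_mod_right, Nat.add_div_right _ ht] at hb
  rw [Nat.add_sub_cancel, mem_runnerSet ht]
  omega

theorem IsSubClosed.sub_mul_mem {t : ℕ} {B : Finset ℕ} (h : IsSubClosed t B) {b : ℕ} (k : ℕ)
    (hb : b + t * k ∈ B) : b ∈ B := by
  induction k with
  | zero => simpa using hb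
  | succ k ih =>
    apply ih
    convert h _ hb (by rw [mul_add]; omega) using 1
    rw [mul_add]
    omega

theorem IsSubClosed.exists_runnerSet_eq {t : ℕ} (ht : 0 < t) {B : Finset ℕ} (h : IsSubClosed t B) :
    ∃ n : ℕ →₀ ℕ, n.support ⊆ range t ∧ runnerSet t n = B := by
  have hex (r : ℕ) : ∃ y, r + t * y ∉ B := by
    refine ⟨B.sup id + 1, fun hy ↦ ?_⟩
    have := le_sup (f := id) hy
    simp only [id] at this
    nlinarith
  classical
  refine ⟨Finsupp.onFinset (range t) (fun r ↦ if r < t then Nat.find (hex r) else 0) ?_,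
    Finsupp.support_onFinset_subset, ?_⟩
  · intro r hr
    by_contra h
    rw [mem_range] at h
    simp [h] at hr
  ext x
  rw [mem_runnerSet ht, Finsupp.onFinset_apply, if_pos (Nat.mod_lt _ ht)]
  constructor
  · intro hx
    have := Nat.find_min _ hx
    rwa [not_not, Nat.mod_add_div] at this
  · intro hx
    by_contra hlt
    rw [not_lt] at hlt
    obtain ⟨k, hk⟩ := Nat.exists_eq_add_of_le hlt
    refine Nat.find_spec (hex (x % t)) (h.sub_mul_mem k ?_)
    rwa [add_assoc, ← mul_add, ← hk, Nat.mod_add_div]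

theorem runnerSet_inj {t : ℕ} (ht : 0 < t) {n n' : ℕ →₀ ℕ} (hn : n.support ⊆ range t)
    (hn' : n'.support ⊆ range t) (h : runnerSet t n = runnerSet t n') : n = n' := by
  ext r
  by_cases hr : r < t
  · have key (y : ℕ) : y < n r ↔ y < n' r := by
      have := congrArg (r + t * y ∈ ·) h
      simpa [mem_runnerSet ht, Nat.mod_eq_of_lt hr, Nat.add_mul_div_left _ _ ht,
        Nat.div_eq_of_lt hr] using this
    exact le_antisymm (not_lt.1 fun h ↦ (lt_irrefl _ ((key _).1 h)).elim)
      (not_lt.1 fun h ↦ (lt_irrefl _ ((key _).2 h)).elim)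
  · have h1 : r ∉ n.support := fun h ↦ hr (mem_range.1 (hn h))
    have h2 : r ∉ n'.support := fun h ↦ hr (mem_range.1 (hn' h))
    rw [Finsupp.notMem_support_iff.1 h1, Finsupp.notMem_support_iff.1 h2]

theorem card_isSubClosed {t : ℕ} (ht : 0 < t) (N s : ℕ) :
    Nat.card {B : Finset ℕ // #B = N ∧ ∑ b ∈ B, b = s ∧ IsSubClosed t B} =
      #{n ∈ finsuppAntidiag (range t) N | runnerSum t n = s} := by
  have hmem (n : {n ∈ finsuppAntidiag (range t) N | runnerSum t n = s}) :
      #(runnerSet t n) = N ∧ ∑ b ∈ runnerSet t n, b = s ∧ IsSubClosed t (runnerSet t n) := by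
    obtain ⟨n, hn⟩ := n
    rw [mem_filter, mem_finsuppAntidiag] at hn
    exact ⟨(card_runnerSet t n).trans hn.1.1, (sum_runnerSet t n).trans hn.2,
      isSubClosed_runnerSet ht n⟩
  rw [← Nat.card_eq_finsetCard]
  refine (Nat.card_congr (Equiv.ofBijective (fun n ↦ ⟨runnerSet t n.1, hmem n⟩) ⟨?_, ?_⟩)).symm
  · rintro ⟨n, hn⟩ ⟨n', hn'⟩ h
    rw [mem_filter, mem_finsuppAntidiag] at hn hn'
    exact Subtype.ext (runnerSet_inj ht hn.1.2 hn'.1.2 (congrArg Subtype.val h))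
  · rintro ⟨B, hB, hs, hc⟩
    obtain ⟨n, hn, rfl⟩ := hc.exists_runnerSet_eq ht
    refine ⟨⟨n, ?_⟩, rfl⟩
    rw [mem_filter, mem_finsuppAntidiag]
    exact ⟨⟨(card_runnerSet t n).symm.trans hB, hn⟩, (sum_runnerSet t n).symm.trans hs⟩

/-- The first-column hook lengths of the partition with row lengths `f`, padded to `N` rows. -/
def betaSet (N : ℕ) (f : ℕ → ℕ) : Finset ℕ := (range N).image fun i ↦ f i + (N - 1 - i)

theorem betaSet_injOn {f : ℕ → ℕ} (hf : Antitone f) (N : ℕ) :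
    Set.InjOn (fun i ↦ f i + (N - 1 - i)) (range N) := by
  intro i hi j hj h
  simp only [coe_range, Set.mem_Iio] at hi hj h
  rcases le_total i j with hij | hij <;> have := hf hij <;> omega

theorem card_betaSet {f : ℕ → ℕ} (hf : Antitone f) (N : ℕ) : #(betaSet N f) = N := by
  rw [betaSet, card_image_of_injOn (betaSet_injOn hf N), card_range]

theorem sum_betaSet {f : ℕ → ℕ} (hf : Antitone f) (N : ℕ) :
    ∑ b ∈ betaSet N f, b = ∑ i ∈ range N, f i + N.choose 2 := by
  rw [betaSet, sum_image (betaSet_injOn hf N), sum_add_distrib, sum_range_reflect (fun i ↦ i),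
    sum_range_id, Nat.choose_two_right]

theorem betaSet_inj {f g : ℕ → ℕ} (hf : Antitone f) (hg : Antitone g) {N : ℕ}
    (h : betaSet N f = betaSet N g) {i : ℕ} (hi : i < N) : f i = g i := by
  have key {f : ℕ → ℕ} (hf : Antitone f) (h : betaSet N f = betaSet N g) :
      (fun k : Fin N ↦ f (N - 1 - k) + k) = (betaSet N g).orderEmbOfFin (card_betaSet hg N) := by
    refine orderEmbOfFin_unique _ (fun k ↦ ?_) fun k l hkl ↦ ?_
    · rw [← h]
      refine mem_image.2 ⟨N - 1 - k, mem_range.2 (by omega), ?_⟩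
      have := k.2
      omega
    · have := hf (by omega : N - 1 - (l : ℕ) ≤ N - 1 - (k : ℕ))
      have hkl : (k : ℕ) < l := hkl
      omega
  have := congrFun ((key hf h).trans (key hg rfl).symm) ⟨N - 1 - i, by omega⟩
  simp only [show N - 1 - (N - 1 - i) = i by omega] at this
  omega

theorem StrictMono.add_sub_le_apply {N : ℕ} {e : Fin N → ℕ} (he : StrictMono e) {k l : ℕ}
    (hl : l < N) (hkl : k ≤ l) : e ⟨k, hkl.trans_lt hl⟩ + (l - k) ≤ e ⟨l, hl⟩ := by
  induction l, hkl using Nat.le_induction with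
  | base => simp
  | succ l hkl ih =>
    have := ih (by omega)
    have := he (show (⟨l, by omega⟩ : Fin N) < ⟨l + 1, hl⟩ from Nat.lt_succ_self l)
    omega

theorem exists_betaSet_eq {N : ℕ} {B : Finset ℕ} (hB : #B = N) :
    ∃ f : ℕ → ℕ, Antitone f ∧ (∀ i, N ≤ i → f i = 0) ∧ betaSet N f = B := by
  have he := (B.orderEmbOfFin hB).strictMono
  have hf : Antitone fun i ↦ if h : i < N then
      B.orderEmbOfFin hB ⟨N - 1 - i, by omega⟩ - (N - 1 - i) else 0 := by
    intro i j hij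
    dsimp only
    split_ifs with hj hi
    · have := he.add_sub_le_apply (by omega : N - 1 - i < N) (by omega : N - 1 - j ≤ N - 1 - i)
      omega
    · omega
    · exact Nat.zero_le _
    · exact le_rfl
  refine ⟨_, hf, fun i hi ↦ dif_neg (by omega), eq_of_subset_of_card_le ?_ ?_⟩
  · rw [betaSet, image_subset_iff]
    intro i hi
    rw [mem_range] at hi
    have := he.add_sub_le_apply (by omega : N - 1 - i < N) (Nat.zero_le _)
    rw [dif_pos hi, Nat.sub_add_cancel (by omega)]
    exact orderEmbOfFin_mem _ _ _
  · rw [card_betaSet hf, hB]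

theorem isSubClosed_betaSet_iff {t N : ℕ} (ht : 0 < t) {f c : ℕ → ℕ}
    (hfc : ∀ i j, i < c j ↔ j < f i) (h0 : ∀ i, N ≤ i → f i = 0) :
    IsSubClosed t (betaSet N f) ↔ ∀ i j, j < f i → ¬ t ∣ f i - j + (c j - i) - 1 := by
  have hcN (j : ℕ) : c j ≤ N := by
    by_contra! h
    have := (hfc N j).1 h
    rw [h0 N le_rfl] at this
    omega
  have hiN {i j : ℕ} (h : j < f i) : i < N := by
    by_contra! hi
    have := h0 i hi
    omega
  constructor
  · rintro h i j hij ⟨k, hk⟩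
    have hmem : N + j - c j ∈ betaSet N f := by
      refine h.sub_mul_mem k (mem_image.2 ⟨i, mem_range.2 (hiN hij), ?_⟩)
      have := (hfc i j).2 hij
      have := hcN j
      have := hiN hij
      omega
    obtain ⟨l, hl, e⟩ := mem_image.1 hmem
    rw [mem_range] at hl
    have := hfc l j
    have := hcN j
    omega
  · intro h b hb htb
    by_contra hx
    obtain ⟨i, hi, rfl⟩ := mem_image.1 hb
    rw [mem_range] at hi
    obtain ⟨x, hxt⟩ := Nat.exists_eq_add_of_le' htb
    rw [hxt, Nat.add_sub_cancel] at hx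
    have hex : ∃ k, f k + N ≤ x + k := ⟨N, by rw [h0 N le_rfl]; omega⟩
    obtain ⟨k, hk, hmin⟩ : ∃ k, f k + N ≤ x + k ∧ ∀ l < k, ¬ f l + N ≤ x + l :=
      ⟨Nat.find hex, Nat.find_spec hex, fun _ ↦ Nat.find_min hex⟩
    have hkN : k ≤ N := by
      by_contra! hlt
      exact hmin N hlt (by rw [h0 N le_rfl]; omega)
    have hck : c (x + k - N) = k := by
      refine le_antisymm (not_lt.1 fun hlt ↦ ?_) ?_
      · have := (hfc _ _).1 hlt
        omega
      · obtain _ | k := k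
        · exact Nat.zero_le _
        have := hmin k (Nat.lt_succ_self k)
        have hne : f k + (N - 1 - k) ≠ x := fun e ↦
          hx (mem_image.2 ⟨k, mem_range.2 hkN, e⟩)
        exact (hfc _ _).2 (by omega)
    have hik : i < k := by
      by_contra! hki
      have h1 := hfc k (f i - 1)
      have h2 := hfc i (f i - 1)
      omega
    have hj := (hfc i (x + k - N)).1 (by omega)
    refine h i _ hj ?_
    rw [hck]
    have : f i - (x + k - N) + (k - i) - 1 = t := by omega
    rw [this]

theorem List.lt_countP_iff_of_pairwise {l : List ℕ} (hl : l.Pairwise (· ≥ ·)) (i j : ℕ) :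
    i < l.countP (j < ·) ↔ j < l.getD i 0 := by
  induction l generalizing i with
  | nil => simp
  | cons a l ih =>
    rw [List.pairwise_cons] at hl
    have ih := ih hl.2
    rw [List.countP_cons]
    by_cases hj : j < a
    · cases i with
      | zero => simp [hj]
      | succ i => simpa [hj] using ih i
    · have h0 : l.countP (j < ·) = 0 := by
        rw [List.countP_eq_zero]
        intro b hb
        have := hl.1 b hb
        simp only [decide_eq_true_eq]
        omega
      rw [h0] at ih ⊢
      cases i with
      | zero => simp [hj]
      | succ i => simpa [hj] using ih i

theorem List.map_getD_range {l : List ℕ} {N : ℕ} (h : l.length ≤ N) :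
    (List.range N).map (l.getD · 0) = l ++ List.replicate (N - l.length) 0 := by
  refine List.ext_getElem (by simp [h]) fun i h1 h2 ↦ ?_
  rw [List.getElem_append]
  split_ifs with hi
  · simp [hi]
  · simp [not_lt.1 hi]

section Rows

variable {m : ℕ} (p : m.Partition)

/-- The length of a row of the Ferrers–Young diagram. -/
def rowLen (i : ℕ) : ℕ := (p.parts.sort (· ≤ ·)).reverse.getD i 0

theorem lt_card_filter_iff (i j : ℕ) :
    i < (p.parts.filter (fun x ↦ j < x)).card ↔ j < rowLen p i := by
  have hl : (p.parts.sort (· ≤ ·)).reverse.Pairwise (· ≥ ·) := by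
    rw [List.pairwise_reverse]
    exact Multiset.pairwise_sort _ _
  rw [rowLen, ← List.lt_countP_iff_of_pairwise hl, ← Multiset.countP_eq_card_filter,
    List.countP_reverse, ← Multiset.coe_countP, Multiset.sort_eq]

theorem antitone_rowLen : Antitone (rowLen p) := by
  intro i i' h
  by_contra! hlt
  have h1 := (lt_card_filter_iff p i' _).2 hlt
  have h2 := lt_card_filter_iff p i (rowLen p i)
  omega

theorem parts_card_le : p.parts.card ≤ m := by
  have := Multiset.card_nsmul_le_sum (s := p.parts) (a := 1) fun x hx ↦ p.parts_pos hx
  simpa [p.parts_sum] using this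

variable {p} {N : ℕ}

theorem rowLen_eq_zero (hN : m ≤ N) (i : ℕ) (hi : N ≤ i) : rowLen p i = 0 := by
  have := parts_card_le p
  exact List.getD_eq_default _ _ (by simp; omega)

theorem map_rowLen (hN : m ≤ N) : (Multiset.range N).map (rowLen p) =
    p.parts + Multiset.replicate (N - p.parts.card) 0 := by
  have h := List.map_getD_range (l := (p.parts.sort (· ≤ ·)).reverse) (N := N)
    (by simpa using (parts_card_le p).trans hN)
  have := congrArg (fun l : List ℕ ↦ (l : Multiset ℕ)) h
  rw [← Multiset.coe_add, Multiset.coe_reverse, Multiset.sort_eq, List.length_reverse,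
    Multiset.length_sort, Multiset.coe_replicate] at this
  exact this

theorem sum_rowLen (hN : m ≤ N) : ∑ i ∈ range N, rowLen p i = m := by
  change ((Multiset.range N).map (rowLen p)).sum = m
  rw [map_rowLen hN]
  simp [p.parts_sum]

theorem parts_eq_filter (hN : m ≤ N) :
    p.parts = ((Multiset.range N).map (rowLen p)).filter (· ≠ 0) := by
  rw [map_rowLen hN, Multiset.filter_add, Multiset.filter_eq_self.2 fun x hx ↦ (p.parts_pos hx).ne']
  simp [Multiset.filter_eq_nil, Multiset.mem_replicate]

theorem eq_of_rowLen_eq {q : m.Partition} (hN : m ≤ N) (h : ∀ i < N, rowLen p i = rowLen q i) :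
    p = q := by
  refine Nat.Partition.ext ?_
  rw [parts_eq_filter hN, parts_eq_filter hN,
    Multiset.map_congr rfl fun i hi ↦ h i (Multiset.mem_range.1 hi)]

theorem exists_rowLen_eq {f : ℕ → ℕ} (hf : Antitone f) (h0 : ∀ i, N ≤ i → f i = 0)
    (hs : ∑ i ∈ range N, f i = m) : ∃ p : m.Partition, ∀ i, rowLen p i = f i := by
  refine ⟨Nat.Partition.ofSums m ((Multiset.range N).map f) hs, fun i ↦ ?_⟩
  have key (j : ℕ) : j < rowLen (Nat.Partition.ofSums m ((Multiset.range N).map f) hs) i ↔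
      j < f i := by
    have hcard : ((Nat.Partition.ofSums m ((Multiset.range N).map f) hs).parts.filter
        (fun x ↦ j < x)).card = #{i ∈ range N | j < f i} := by
      change (((Multiset.map f (Multiset.range N)).filter (· ≠ 0)).filter (j < ·)).card = _
      rw [Multiset.filter_filter, Multiset.filter_congr (q := (j < ·)) (by intros; omega),
        Multiset.filter_map, Multiset.card_map]
      rfl
    rw [← lt_card_filter_iff, hcard]
    constructor
    · contrapose!
      intro h
      simpa using card_le_card (t := range i) fun l hl ↦ by
        rw [mem_filter] at hl
        by_contra hli
        have := hf (not_lt.1 (mem_range.not.1 hli))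
        omega
    · intro h
      refine lt_of_lt_of_le (Nat.lt_succ_self i) ?_
      simpa using card_le_card (s := range (i + 1)) (t := {i ∈ range N | j < f i}) fun l hl ↦ by
        have hli : l ≤ i := Nat.lt_succ_iff.1 (mem_range.1 hl)
        have := hf hli
        rw [mem_filter, mem_range]
        refine ⟨?_, by omega⟩
        by_contra! hl
        have := h0 l hl
        omega
  exact le_antisymm (not_lt.1 fun h ↦ lt_irrefl _ ((key _).1 h))
    (not_lt.1 fun h ↦ lt_irrefl _ ((key _).2 h))

end Rows

theorem card_isTCore {t m N : ℕ} (ht : 0 < t) (hN : m ≤ N) :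
    Nat.card {p : m.Partition // IsTCore t p} = Nat.card {B : Finset ℕ //
      #B = N ∧ ∑ b ∈ B, b = N.choose 2 + m ∧ IsSubClosed t B} := by
  have hcore (p : m.Partition) : IsSubClosed t (betaSet N (rowLen p)) ↔ IsTCore t p :=
    isSubClosed_betaSet_iff ht (lt_card_filter_iff p) (rowLen_eq_zero hN)
  refine Nat.card_congr (Equiv.ofBijective (fun p ↦ ⟨betaSet N (rowLen p.1),
    card_betaSet (antitone_rowLen _) N, ?_, (hcore p.1).2 p.2⟩) ⟨?_, ?_⟩)
  · rw [sum_betaSet (antitone_rowLen _), sum_rowLen hN, add_comm]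
  · rintro ⟨p, hp⟩ ⟨q, hq⟩ h
    exact Subtype.ext (eq_of_rowLen_eq hN fun i hi ↦
      betaSet_inj (antitone_rowLen _) (antitone_rowLen _) (congrArg Subtype.val h) hi)
  · rintro ⟨B, hB, hs, hc⟩
    obtain ⟨f, hf, h0, rfl⟩ := exists_betaSet_eq hB
    rw [sum_betaSet hf, add_comm, Nat.add_left_cancel_iff] at hs
    obtain ⟨p, hp⟩ := exists_rowLen_eq hf h0 hs
    obtain rfl : rowLen p = f := funext hp
    exact ⟨⟨p, (hcore p).1 hc⟩, rfl⟩

theorem coeff_prod_one_add_C_mul_X {R ι : Type*} [CommRing R] (f : ι → R) (s : Finset ι) (k : ℕ) :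
    coeff k (∏ i ∈ s, (1 + C (f i) * X)) = ∑ B ∈ powersetCard k s, ∏ i ∈ B, f i := by
  simp only [prod_one_add, map_sum, prod_mul_distrib, prod_const, ← map_prod, coeff_C_mul_X_pow,
    powersetCard_eq_filter, sum_filter, eq_comm]

theorem subsetSeries_eq_coeff (M k : ℕ) :
    subsetSeries M k = coeff k (∏ i ∈ range M, (1 + C ((X : ℤ⟦X⟧) ^ i) * X)) := by
  rw [coeff_prod_one_add_C_mul_X, subsetSeries]
  exact sum_congr rfl fun B _ ↦ (prod_pow_eq_pow_sum ..).symm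

theorem subsetSeries_mul {t : ℕ} (ht : t ≠ 0) (M N : ℕ) :
    subsetSeries (t * M) N = ∑ n ∈ finsuppAntidiag (range t) N,
      ∏ r ∈ range t, (X ^ (r * n r) * expand t ht (subsetSeries M (n r))) := by
  have hprod : ∏ i ∈ range (t * M), (1 + C ((X : ℤ⟦X⟧) ^ i) * X) =
      ∏ r ∈ range t, ∏ l ∈ range M, (1 + C ((X : ℤ⟦X⟧) ^ (r + t * l)) * X) := by
    rw [prod_comm]
    induction M with
    | zero => simp
    | succ M ih =>
      rw [mul_add, mul_one, prod_range_add, ih, prod_range_succ]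
      simp only [add_comm]
  rw [subsetSeries_eq_coeff, hprod, coeff_prod]
  refine sum_congr rfl fun n _ ↦ prod_congr rfl fun r _ ↦ ?_
  rw [coeff_prod_one_add_C_mul_X, subsetSeries, map_sum, mul_sum]
  refine sum_congr rfl fun B hB ↦ ?_
  rw [prod_pow_eq_pow_sum, sum_add_distrib, sum_const, (mem_powersetCard.1 hB).2, ← mul_sum,
    map_pow, expand_X, smul_eq_mul, pow_add, pow_mul X t, mul_comm r]

theorem Finset.dvd_prod_sub_prod {R ι : Type*} [CommRing R] {d : R} {f g : ι → R} {s : Finset ι}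
    (h : ∀ i ∈ s, d ∣ f i - g i) : d ∣ ∏ i ∈ s, f i - ∏ i ∈ s, g i := by
  rw [← Ideal.mem_span_singleton, ← Ideal.Quotient.eq, map_prod, map_prod]
  exact prod_congr rfl fun i hi ↦
    (Ideal.Quotient.eq.2 (Ideal.mem_span_singleton.2 (h i hi)))

theorem X_pow_dvd_expand_of_le {t : ℕ} (ht : t ≠ 0) {k l : ℕ} (hkl : k ≤ l) {f : ℤ⟦X⟧}
    (h : X ^ l ∣ f) : X ^ k ∣ expand t ht f := by
  obtain ⟨g, rfl⟩ := h
  rw [map_mul, map_pow, expand_X, ← pow_mul]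
  exact Dvd.dvd.mul_right (pow_dvd_pow _ (hkl.trans (Nat.le_mul_of_pos_left _ (by omega)))) _

theorem X_pow_dvd_pow_mul_prod_sub {t : ℕ} (ht : t ≠ 0) {N m M : ℕ} (hN : t * (m + 1) + m ≤ N)
    (hM : N + N.choose 2 + m + 1 ≤ M) {n : ℕ →₀ ℕ} (hn : ∑ r ∈ range t, n r = N) :
    X ^ (N.choose 2 + m + 1) ∣ expand t ht (pentagonalSeries ℤ) ^ t *
      ∏ r ∈ range t, (X ^ (r * n r) * expand t ht (subsetSeries M (n r))) - X ^ runnerSum t n := by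
  set T := ∏ r ∈ range t, ((X : ℤ⟦X⟧) ^ (r * n r) * expand t ht (subsetSeries M (n r)))
  have hnN (r : ℕ) (hr : r ∈ range t) : n r ≤ N :=
    hn ▸ single_le_sum (f := n) (fun _ _ ↦ Nat.zero_le _) hr
  have hQ : IsUnit (∏ r ∈ range t, expand t ht (qPoch (n r))) := by
    rw [IsUnit.prod_iff]
    exact fun r _ ↦ (isUnit_qPoch _).map _
  have h1 : X ^ (N.choose 2 + m + 1) ∣ T * ∏ r ∈ range t, expand t ht (qPoch (n r)) -
      X ^ runnerSum t n := by
    have e : (X : ℤ⟦X⟧) ^ runnerSum t n =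
        ∏ r ∈ range t, (X ^ (r * n r) * expand t ht (X ^ (n r).choose 2)) := by
      rw [runnerSum, ← prod_pow_eq_pow_sum]
      simp only [map_pow, expand_X, ← pow_mul, pow_add]
    rw [e, ← prod_mul_distrib]
    refine dvd_prod_sub_prod fun r hr ↦ ?_
    rw [mul_assoc, ← map_mul, ← mul_sub, ← map_sub]
    refine Dvd.dvd.mul_left (X_pow_dvd_expand_of_le ht ?_
      (Nat.add_sub_of_le ((hnN r hr).trans (by omega : N ≤ M)) ▸
        X_pow_dvd_subsetSeries_mul_qPoch_sub (n r) (M - n r))) _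
    have := hnN r hr
    omega
  by_cases hS : runnerSum t n < N.choose 2 + m + 1
  · have hT : X ^ runnerSum t n ∣ T := by
      rw [← hQ.dvd_mul_right, ← dvd_sub_self_right]
      exact (pow_dvd_pow _ hS.le).trans h1
    have h2 : X ^ (m + 1) ∣ expand t ht (pentagonalSeries ℤ) ^ t -
        ∏ r ∈ range t, expand t ht (qPoch (n r)) := by
      have e : expand t ht (pentagonalSeries ℤ) ^ t =
          ∏ _ ∈ range t, expand t ht (pentagonalSeries ℤ) := by simp
      rw [e]
      refine dvd_prod_sub_prod fun r hr ↦ ?_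
      rw [← map_sub]
      refine X_pow_dvd_expand_of_le ht ?_ (X_pow_dvd_pentagonalSeries_sub _)
      have := choose_two_add_le_runnerSum (mem_range.1 hr) n
      rw [hn] at this
      have hr := mem_range.1 hr
      by_contra! hlt
      have := Nat.mul_le_mul_left t (by omega : n r + 1 ≤ m)
      rw [mul_add] at this hN
      omega
    have h3 := choose_two_le_runnerSum t n
    rw [hn] at h3
    have h4 := (pow_dvd_pow X (by omega : N.choose 2 + m + 1 ≤ m + 1 + runnerSum t n)).trans
      (pow_add (X : ℤ⟦X⟧) (m + 1) _ ▸ mul_dvd_mul h2 hT)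
    convert h4.add h1 using 1
    ring
  · have hX : (X : ℤ⟦X⟧) ^ (N.choose 2 + m + 1) ∣ X ^ runnerSum t n := pow_dvd_pow _ (by omega)
    refine dvd_sub (Dvd.dvd.mul_left ?_ _) hX
    rw [← hQ.dvd_mul_right]
    exact (dvd_iff_dvd_of_dvd_sub h1).2 hX

theorem X_pow_dvd_sum_sub {t : ℕ} (ht : 0 < t) {N m : ℕ} (hN : m ≤ N) :
    X ^ (N.choose 2 + m + 1) ∣ ∑ n ∈ finsuppAntidiag (range t) N, (X : ℤ⟦X⟧) ^ runnerSum t n -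
      X ^ N.choose 2 * coreSeries t := by
  rw [X_pow_dvd_iff]
  intro s hs
  rw [map_sub, sub_eq_zero, map_sum, coeff_X_pow_mul']
  simp only [coeff_X_pow, eq_comm (a := s)]
  rw [sum_boole]
  split_ifs with h
  · obtain ⟨l, rfl⟩ := Nat.exists_eq_add_of_le h
    rw [Nat.add_sub_cancel_left, coreSeries, coeff_mk, card_isTCore ht (by omega : l ≤ N),
      card_isSubClosed ht]
  · rw [filter_eq_empty_iff.2, card_empty, Nat.cast_zero]
    intro n hn
    have := choose_two_le_runnerSum t n
    rw [(mem_finsuppAntidiag.1 hn).1] at this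
    omega

theorem pentagonalSeries_mul_coreSeries {t : ℕ} (ht : t ≠ 0) :
    pentagonalSeries ℤ * coreSeries t = expand t ht (pentagonalSeries ℤ) ^ t := by
  refine eq_of_forall_X_pow_dvd_sub fun m ↦ ?_
  set N := t * (m + 1) + m
  set M := N + N.choose 2 + m + 1
  have hM : M ≤ t * M := Nat.le_mul_of_pos_left _ (by omega)
  have h1 := X_pow_dvd_sum_sub (Nat.pos_of_ne_zero ht) (by omega : m ≤ N)
  have h2 : X ^ (N.choose 2 + m + 1) ∣ expand t ht (pentagonalSeries ℤ) ^ t *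
      subsetSeries (t * M) N - ∑ n ∈ finsuppAntidiag (range t) N, (X : ℤ⟦X⟧) ^ runnerSum t n := by
    rw [subsetSeries_mul ht, mul_sum, ← sum_sub_distrib]
    exact dvd_sum fun n hn ↦ X_pow_dvd_pow_mul_prod_sub ht le_rfl le_rfl (mem_finsuppAntidiag.1 hn).1
  have h3 : X ^ (N.choose 2 + m + 1) ∣ pentagonalSeries ℤ * subsetSeries (t * M) N -
      X ^ N.choose 2 := by
    have h4 := X_pow_dvd_pentagonalSeries_sub N
    have h5 : X ^ N.choose 2 ∣ subsetSeries (t * M) N := dvd_sum fun B hB ↦ pow_dvd_pow _ <| by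
      simpa only [(mem_powersetCard.1 hB).2] using card_choose_two_le_sum B
    have h6 := X_pow_dvd_subsetSeries_mul_qPoch_sub N (t * M - N)
    rw [Nat.add_sub_of_le (by omega)] at h6
    have h7 := (pow_dvd_pow X (by omega : N.choose 2 + m + 1 ≤ N + 1 + N.choose 2)).trans
      (pow_add (X : ℤ⟦X⟧) (N + 1) _ ▸ mul_dvd_mul h4 h5)
    convert h7.add ((pow_dvd_pow X (by omega)).trans h6) using 1
    ring
  have h8 : X ^ (N.choose 2) * X ^ (m + 1) ∣ X ^ (N.choose 2) *
      (pentagonalSeries ℤ * coreSeries t - expand t ht (pentagonalSeries ℤ) ^ t) := by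
    rw [← pow_add, ← add_assoc]
    convert ((h3.mul_left (expand t ht (pentagonalSeries ℤ) ^ t)).sub
      ((h1.add h2).mul_left (pentagonalSeries ℤ))) using 1
    ring
  exact (mul_dvd_mul_iff_left (pow_ne_zero _ X_ne_zero)).1 h8

theorem dvd_numA_five (i n : ℕ) : 15625 ∣ numA 5 (390625 * i + 4) (125 * n + 121) := by
  obtain ⟨u, hu⟩ := isUnit_pentagonalSeries.exists_right_inv
  refine dvd_numA hu ?_ i n
  rw [← pentagonalSeries_mul_coreSeries (by norm_num), mul_right_comm, hu, one_mul]

end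

theorem stmt_18 : ∀ i n : ℕ, 15625 ∣ numA 5 (390625 * i + 4) (125 * n + 121) := by
  exact fun i n ↦ dvd_numA_five i n
end
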